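/- arXiv:math/0611617 — 3 statements merged into one kernel-verified Lean document; each statement's English description precedes it below -/
import Mathlib

section
/- (Existence of Hall polynomials.) For every triple of partitions λ, μ, ν with |λ| + |μ| = |ν| there exists a unique polynomial P ∈ ℤ[t] such that for every finite field k, the number of k[X]-submodules L ⊆ I_ν(k) with L isomorphic to I_λ(k) and I_ν(k)/L isomorphic to I_μ(k) equals the value of P at the cardinality of k. -/
/-- The nilpotent `k[X]`-module `I_λ = ⊕_i (k[X]/(Xⁱ))^{⊕ λ(i)}` attached to a partition
in multiplicity notation (`m i` = number of parts equal to `i`). -/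
noncomputable def Imod (k : Type) [Field k] (m : ℕ →₀ ℕ) : Type :=
  DirectSum ℕ (fun i => Fin (m i) → Polynomial k ⧸ Ideal.span {(Polynomial.X : Polynomial k) ^ i})

noncomputable instance (k : Type) [Field k] (m : ℕ →₀ ℕ) : AddCommGroup (Imod k m) :=
  inferInstanceAs (AddCommGroup (DirectSum ℕ
    (fun i => Fin (m i) → Polynomial k ⧸ Ideal.span {(Polynomial.X : Polynomial k) ^ i})))

noncomputable instance (k : Type) [Field k] (m : ℕ →₀ ℕ) : Module (Polynomial k) (Imod k m) :=
  inferInstanceAs (Module (Polynomial k) (DirectSum ℕ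
    (fun i => Fin (m i) → Polynomial k ⧸ Ideal.span {(Polynomial.X : Polynomial k) ^ i})))

/-- `hallPart k ν μ λ` is the Hall number `g^ν_{μ,λ}(k)`: the number of `k[X]`-submodules
`L ⊆ I_ν` with `L ≅ I_λ` and `I_ν/L ≅ I_μ`. -/
noncomputable def hallPart (k : Type) [Field k] (ν μ lam : ℕ →₀ ℕ) : ℕ :=
  Nat.card {L : Submodule (Polynomial k) (Imod k ν) //
    Nonempty (↥L ≃ₗ[Polynomial k] Imod k lam) ∧
    Nonempty ((Imod k ν ⧸ L) ≃ₗ[Polynomial k] Imod k μ)}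

namespace HallPoly

open Polynomial

/-- The dimension over a finite field `k` of a finite `k`-vector space, read off its cardinality. -/
noncomputable def dm (k M : Type) : ℕ := Nat.log (Nat.card k) (Nat.card M)

/-- The submodule `X ^ i • M`. -/
noncomputable def pw (k : Type) [Field k] (M : Type) [AddCommGroup M] [Module k[X] M] (i : ℕ) :
    Submodule k[X] M :=
  LinearMap.range (LinearMap.lsmul k[X] M (X ^ i))

/-- The submodule of elements killed by `X`. -/
noncomputable def kx (k : Type) [Field k] (M : Type) [AddCommGroup M] [Module k[X] M] :
    Submodule k[X] M :=
  LinearMap.ker (LinearMap.lsmul k[X] M X)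

/-- The type of a finite `k[X]`-module: the sequence of dimensions of `X ^ i • M`. -/
noncomputable def tp (k : Type) [Field k] (M : Type) [AddCommGroup M] [Module k[X] M] :
    ℕ → ℕ :=
  fun i => dm k (pw k M i)

section Dimension

variable {k : Type} [Field k] {M N : Type} [AddCommGroup M] [Module k[X] M]
  [AddCommGroup N] [Module k[X] N]

theorem one_lt_natCard (k : Type) [Field k] [Finite k] : 1 < Nat.card k :=
  Finite.one_lt_card

theorem natCard_eq (k : Type) [Field k] [Finite k] (M : Type) [AddCommGroup M] [Module k[X] M]
    [Finite M] : Nat.card M = Nat.card k ^ dm k M := by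
  let _ : Module k M := Module.compHom M (algebraMap k k[X])
  have h := Module.natCard_eq_pow_finrank (K := k) (V := M)
  rw [dm, h, Nat.log_pow (one_lt_natCard k)]

theorem dm_eq_of_natCard {k M : Type} [Field k] [Finite k] {n : ℕ}
    (h : Nat.card M = Nat.card k ^ n) : dm k M = n := by
  rw [dm, h, Nat.log_pow (one_lt_natCard k)]

theorem dm_congr {k M N : Type} (e : M ≃ N) : dm k M = dm k N := by
  rw [dm, dm, Nat.card_congr e]

instance [Finite M] (L : Submodule k[X] M) : Finite (M ⧸ L) :=
  Finite.of_surjective _ L.mkQ_surjective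

theorem dm_map [Finite k] [Finite M] (f : M →ₗ[k[X]] N) (L : Submodule k[X] M) :
    dm k L = dm k (L ⊓ LinearMap.ker f : Submodule k[X] M) + dm k (L.map f) := by
  have : Finite (L.map f) := by
    rw [← LinearMap.range_domRestrict]
    exact Finite.of_surjective _ (f.domRestrict L).surjective_rangeRestrict
  apply dm_eq_of_natCard
  rw [pow_add, ← natCard_eq, ← natCard_eq,
    Submodule.card_eq_card_quotient_mul_card (LinearMap.ker (f.domRestrict L))]
  congr 1
  · rw [LinearMap.ker_domRestrict]
    rw [← Submodule.map_comap_subtype]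
    exact Nat.card_congr (Submodule.equivSubtypeMap L _).toEquiv
  · rw [← LinearMap.range_domRestrict]
    exact Nat.card_congr (LinearMap.quotKerEquivRange _).toEquiv

theorem dm_mono [Finite k] [Finite M] {L L' : Submodule k[X] M} (h : L ≤ L') :
    dm k L ≤ dm k L' :=
  Nat.log_mono_right (Nat.card_le_card_of_injective _ (Submodule.inclusion_injective h))

theorem eq_of_dm_le [Finite k] [Finite M] {L L' : Submodule k[X] M} (h : L ≤ L')
    (hd : dm k L' ≤ dm k L) : L = L' := by
  have hd' := le_antisymm hd (dm_mono h)
  have hc : Nat.card L' = Nat.card L := by rw [natCard_eq k L', hd', ← natCard_eq]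
  apply SetLike.coe_injective
  exact Set.eq_of_subset_of_ncard_le h hc.le

theorem dm_bot [Finite k] : dm k (⊥ : Submodule k[X] M) = 0 :=
  dm_eq_of_natCard (by simp)

theorem dm_top : dm k (⊤ : Submodule k[X] M) = dm k M :=
  dm_congr (Submodule.topEquiv (R := k[X]) (M := M)).toEquiv

theorem eq_bot_of_dm_eq_zero [Finite k] [Finite M] {L : Submodule k[X] M} (h : dm k L = 0) :
    L = ⊥ :=
  (eq_of_dm_le bot_le (by rw [h]; exact Nat.zero_le _)).symm

theorem dm_quotient [Finite k] [Finite M] (L : Submodule k[X] M) :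
    dm k M = dm k L + dm k (M ⧸ L) := by
  rw [← dm_top (M := M), dm_map L.mkQ ⊤, Submodule.ker_mkQ, top_inf_eq, Submodule.map_top,
    Submodule.range_mkQ, dm_top]

end Dimension

section Types

variable {k : Type} [Field k] {M N : Type} [AddCommGroup M] [Module k[X] M]
  [AddCommGroup N] [Module k[X] N]

theorem mem_pw {i : ℕ} {x : M} : x ∈ pw k M i ↔ ∃ y : M, (X ^ i : k[X]) • y = x := Iff.rfl

theorem mem_kx {x : M} : x ∈ kx k M ↔ (X : k[X]) • x = 0 := Iff.rfl

theorem pw_zero : pw k M 0 = ⊤ := by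
  ext x
  simp [mem_pw]

theorem map_pw {f : M →ₗ[k[X]] N} (hf : Function.Surjective f) (i : ℕ) :
    (pw k M i).map f = pw k N i := by
  ext x
  simp only [Submodule.mem_map, mem_pw]
  constructor
  · rintro ⟨_, ⟨y, rfl⟩, rfl⟩
    exact ⟨f y, by simp⟩
  · rintro ⟨y, rfl⟩
    obtain ⟨z, rfl⟩ := hf y
    exact ⟨_, ⟨z, rfl⟩, by simp⟩

theorem map_pw_subtype_le (L : Submodule k[X] M) (i : ℕ) :
    (pw k L i).map L.subtype ≤ pw k M i := by
  rintro _ ⟨_, ⟨y, rfl⟩, rfl⟩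
  exact ⟨y, by simp⟩

theorem map_smul_pw (i : ℕ) : (pw k M i).map (LinearMap.lsmul k[X] M X) = pw k M (i + 1) := by
  ext x
  simp only [Submodule.mem_map, mem_pw]
  constructor
  · rintro ⟨_, ⟨y, rfl⟩, rfl⟩
    exact ⟨y, by rw [pow_succ', mul_smul]; rfl⟩
  · rintro ⟨y, rfl⟩
    exact ⟨_, ⟨y, rfl⟩, by rw [pow_succ', mul_smul]; rfl⟩

theorem pw_antitone : Antitone (pw k M) := by
  intro i j hij
  rintro _ ⟨y, rfl⟩
  refine ⟨(X ^ (j - i) : k[X]) • y, ?_⟩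
  simp [← mul_smul, ← pow_add, hij]

theorem tp_congr (e : M ≃ₗ[k[X]] N) : tp k M = tp k N := by
  ext i
  rw [tp, tp, ← map_pw e.surjective]
  exact dm_congr (e.submoduleMap _).toEquiv

theorem tp_zero : tp k M 0 = dm k M := by
  rw [tp, pw_zero, dm_top]

variable [Finite k] [Finite M]

theorem tp_eq_add_tp_quotient (E : Submodule k[X] M) (i : ℕ) :
    tp k M i = dm k (pw k M i ⊓ E : Submodule k[X] M) + tp k (M ⧸ E) i := by
  rw [tp, dm_map E.mkQ, Submodule.ker_mkQ, map_pw E.mkQ_surjective, tp]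

theorem tp_eq_add_tp_succ (i : ℕ) :
    tp k M i = dm k (pw k M i ⊓ kx k M : Submodule k[X] M) + tp k M (i + 1) := by
  rw [tp, dm_map (LinearMap.lsmul k[X] M X), map_smul_pw]
  rfl

theorem tp_quotient_le (E : Submodule k[X] M) : tp k (M ⧸ E) ≤ tp k M := fun i =>
  (Nat.le_add_left _ _).trans_eq (tp_eq_add_tp_quotient E i).symm

theorem tp_submodule_le (L : Submodule k[X] M) : tp k L ≤ tp k M := fun i => by
  refine le_trans (le_of_eq ?_) (dm_mono (map_pw_subtype_le L i))
  exact dm_congr (Submodule.equivSubtypeMap L _).toEquiv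

theorem dm_kx : tp k M 0 = dm k (kx k M) + tp k M 1 := by
  rw [tp_eq_add_tp_succ 0, pw_zero, top_inf_eq]

theorem tp_const_of_eq (h : tp k M 0 = tp k M 1) (i : ℕ) : tp k M i = tp k M 0 := by
  have h0 : dm k (kx k M) = 0 := by have := dm_kx (k := k) (M := M); omega
  induction i with
  | zero => rfl
  | succ i ih =>
    have := tp_eq_add_tp_succ (k := k) (M := M) i
    rw [eq_bot_of_dm_eq_zero h0, inf_bot_eq, dm_bot] at this
    omega

end Types

theorem eval_pow_sub_pow (a b : ℕ) (q : ℤ) :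
    ((X ^ a - X ^ b : ℤ[X])).eval q = q ^ a - q ^ b := by simp

theorem monic_pow_sub_pow {a b : ℕ} (h : b < a) : (X ^ a - X ^ b : ℤ[X]).Monic :=
  monic_X_pow_sub (by rw [degree_X_pow]; exact_mod_cast h)

/-- Divisibility of integer polynomials by a monic one can be tested on infinitely many values. -/
theorem dvd_of_infinite_eval_dvd {A B : ℤ[X]} (hA : A.Monic)
    (h : {q : ℕ | A.eval (q : ℤ) ∣ B.eval (q : ℤ)}.Infinite) : A ∣ B := by
  rw [← modByMonic_eq_zero_iff_dvd hA]
  set R := B %ₘ A with hR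
  have hdeg : R.degree < A.degree := degree_modByMonic_lt B hA
  have hdvd : {q : ℕ | A.eval (q : ℤ) ∣ R.eval (q : ℤ)}.Infinite := by
    refine h.mono fun q hq => ?_
    have hB := congrArg (eval (q : ℤ)) (modByMonic_add_div B A)
    simp only [eval_add, eval_mul] at hB
    simp only [Set.mem_ofPred_eq] at hq ⊢
    rw [← hB] at hq
    exact (dvd_add_left (dvd_mul_right _ _)).1 hq
  have hlim := div_tendsto_atTop_zero_of_degree_lt (R.map (Int.castRingHom ℝ))
    (A.map (Int.castRingHom ℝ)) (by
      rwa [degree_map_eq_of_injective Int.cast_injective,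
        degree_map_eq_of_injective Int.cast_injective])
  have hev := (hlim.comp tendsto_natCast_atTop_atTop).eventually
    (Metric.ball_mem_nhds (0 : ℝ) one_pos)
  obtain ⟨n₀, hn₀⟩ := Filter.eventually_atTop.1 hev
  apply eq_zero_of_infinite_isRoot
  have hinf : ({q : ℕ | A.eval (q : ℤ) ∣ R.eval (q : ℤ)} \ (Set.Iio n₀ ∪
      {q : ℕ | A.eval (q : ℤ) = 0})).Infinite := by
    refine hdvd.sdiff ((Set.finite_Iio n₀).union ?_)
    refine Set.Finite.preimage (f := fun q : ℕ => (q : ℤ)) (s := {x | IsRoot A x})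
      Nat.cast_injective.injOn (finite_setOfPred_isRoot hA.ne_zero)
  refine (hinf.image (f := fun q : ℕ => (q : ℤ)) Nat.cast_injective.injOn).mono ?_
  rintro _ ⟨q, ⟨hq, hq'⟩, rfl⟩
  simp only [Set.mem_union, Set.mem_Iio, Set.mem_ofPred_eq, not_or, not_lt] at hq'
  have hlt := hn₀ q hq'.1
  have hcast (F : ℤ[X]) :
      (F.map (Int.castRingHom ℝ)).eval (q : ℝ) = ((F.eval (q : ℤ) : ℤ) : ℝ) := by
    simp
  simp only [Function.comp_apply, hcast, dist_zero_right, norm_div,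
    Real.norm_eq_abs] at hlt
  rw [div_lt_one (abs_pos.2 (by exact_mod_cast hq'.2))] at hlt
  exact Int.eq_zero_of_abs_lt_dvd ((abs_dvd _ _).2 hq) (by exact_mod_cast hlt)

/-- The cardinalities of finite fields. -/
theorem infinite_of_finite_fields {p : ℕ → Prop}
    (h : ∀ (k : Type) [Field k] [Finite k], p (Nat.card k)) : {q | p q}.Infinite := by
  refine Nat.infinite_setOfPred_prime.mono fun q hq => ?_
  have : Fact q.Prime := ⟨hq⟩
  simpa using h (ZMod q)

section Lines

variable {k : Type} [Field k] {V : Type} [AddCommGroup V] [Module k[X] V]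

theorem smul_eq_of_X_smul {v : V} (hv : (X : k[X]) • v = 0) (p : k[X]) :
    p • v = (C (p.coeff 0) : k[X]) • v := by
  conv_lhs => rw [← divX_mul_X_add p]
  rw [add_smul, mul_smul, hv, smul_zero, zero_add]

theorem dm_span [Finite k] {v : V} (hv : (X : k[X]) • v = 0) (h0 : v ≠ 0) :
    dm k (Submodule.span k[X] {v}) = 1 := by
  apply dm_eq_of_natCard
  rw [pow_one]
  refine (Nat.card_congr (Equiv.ofBijective (fun c : k =>
    (⟨(C c : k[X]) • v, Submodule.smul_mem _ _ (Submodule.mem_span_singleton_self v)⟩ :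
      Submodule.span k[X] {v})) ⟨?_, ?_⟩)).symm
  · intro a b hab
    by_contra hne
    have h1 : (C (a - b) : k[X]) • v = 0 := by
      rw [C_sub, sub_smul, sub_eq_zero]
      exact congrArg Subtype.val hab
    apply h0
    have h2 := congrArg (fun w => (C (a - b)⁻¹ : k[X]) • w) h1
    rwa [smul_zero, ← mul_smul, ← C_mul, inv_mul_cancel₀ (sub_ne_zero.2 hne), C_1,
      one_smul] at h2
  · rintro ⟨w, hw⟩
    obtain ⟨p, rfl⟩ := Submodule.mem_span_singleton.1 hw
    exact ⟨p.coeff 0, Subtype.ext (smul_eq_of_X_smul hv p).symm⟩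

theorem disjoint_span [Finite k] [Finite V] {v : V} (hv : (X : k[X]) • v = 0)
    {L : Submodule k[X] V} (hL : v ∉ L) : L ⊓ Submodule.span k[X] {v} = ⊥ := by
  have h0 : v ≠ 0 := fun h => hL (h ▸ L.zero_mem)
  apply eq_bot_of_dm_eq_zero
  by_contra hne
  have h := eq_of_dm_le (inf_le_right : L ⊓ Submodule.span k[X] {v} ≤ _)
    (by rw [dm_span hv h0]; omega)
  exact hL (inf_eq_right.1 h (Submodule.mem_span_singleton_self v))

theorem ncard_diff [Finite k] [Finite V] {L L' : Submodule k[X] V} (h : L ≤ L') :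
    ((({v | v ∈ L' ∧ v ∉ L} : Set V).ncard : ℕ) : ℤ)
      = (Nat.card k : ℤ) ^ dm k L' - (Nat.card k : ℤ) ^ dm k L := by
  have h1 := Set.ncard_sdiff_add_ncard_of_subset (s := (L : Set V)) (t := L') h
  have h2 : (L : Set V).ncard = Nat.card k ^ dm k L := natCard_eq k L
  have h3 : (L' : Set V).ncard = Nat.card k ^ dm k L' := natCard_eq k L'
  rw [h2, h3] at h1
  have h4 : ({v | v ∈ L' ∧ v ∉ L} : Set V) = (L' : Set V) \ L := rfl
  rw [h4, eq_sub_iff_add_eq]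
  exact_mod_cast h1

end Lines

/-- A flag of length `N` with dimensions `s` in a `k[X]`-module killed by `X`. -/
structure IsFlag (k : Type) [Field k] {V : Type} [AddCommGroup V] [Module k[X] V] (N : ℕ)
    (s : ℕ → ℕ) (S : ℕ → Submodule k[X] V) : Prop where
  smul : ∀ v : V, (X : k[X]) • v = 0
  anti : Antitone S
  top : S 0 = ⊤
  bot : S N = ⊥
  dim : ∀ i, dm k (S i) = s i

section Flags

variable {k : Type} [Field k] [Finite k] {V : Type} [AddCommGroup V] [Module k[X] V] [Finite V]
  {N : ℕ} {s : ℕ → ℕ} {S : ℕ → Submodule k[X] V}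

theorem IsFlag.dm_inf_span (h : IsFlag k N s S) {v : V} {i : ℕ} (hi : v ∈ S i)
    (hi' : v ∉ S (i + 1)) (j : ℕ) :
    dm k (S j ⊓ Submodule.span k[X] {v} : Submodule k[X] V) = if j ≤ i then 1 else 0 := by
  have h0 : v ≠ 0 := fun h => hi' (h ▸ (S (i + 1)).zero_mem)
  split_ifs with hj
  · rw [inf_eq_right.2, dm_span (h.smul v) h0]
    exact (Submodule.span_singleton_le_iff_mem _ _).2 (h.anti hj hi)
  · rw [disjoint_span (h.smul v), dm_bot]
    exact fun hv => hi' (h.anti (by omega) hv)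

theorem IsFlag.quotient (h : IsFlag k N s S) {v : V} {i : ℕ} (hi : v ∈ S i)
    (hi' : v ∉ S (i + 1)) :
    IsFlag k N (fun j => s j - if j ≤ i then 1 else 0)
      (fun j => (S j).map (Submodule.span k[X] {v}).mkQ) where
  smul := by
    intro w
    obtain ⟨w, rfl⟩ := Submodule.mkQ_surjective _ w
    rw [← map_smul, h.smul, map_zero]
  anti := fun _ _ hij => Submodule.map_mono (h.anti hij)
  top := by simp [h.top]
  bot := by simp [h.bot]
  dim := by
    intro j
    have h1 := dm_map (Submodule.span k[X] {v}).mkQ (S j)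
    rw [Submodule.ker_mkQ, h.dm_inf_span hi hi', h.dim] at h1
    omega

theorem IsFlag.dm_map_inf (h : IsFlag k N s S) {v : V} {i : ℕ} (hi : v ∈ S i)
    (hi' : v ∉ S (i + 1)) (E : Submodule k[X] (V ⧸ Submodule.span k[X] {v})) (j : ℕ) :
    dm k (S j ⊓ E.comap (Submodule.span k[X] {v}).mkQ : Submodule k[X] V)
      = (if j ≤ i then 1 else 0)
        + dm k ((S j).map (Submodule.span k[X] {v}).mkQ ⊓ E : Submodule k[X] _) := by
  rw [dm_map (Submodule.span k[X] {v}).mkQ, Submodule.ker_mkQ, inf_assoc,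
    inf_eq_right.2 (Submodule.le_comap_mkQ _ E), h.dm_inf_span hi hi',
    Submodule.map_inf_eq_map_inf_comap]

/-- The number of submodules meeting the members of a flag in prescribed dimensions. -/
noncomputable def flagCount (k : Type) [Field k] {V : Type} [AddCommGroup V] [Module k[X] V]
    (S : ℕ → Submodule k[X] V) (d : ℕ → ℕ) : ℕ :=
  Nat.card {E : Submodule k[X] V // ∀ i, dm k (S i ⊓ E : Submodule k[X] V) = d i}

theorem IsFlag.card_mem (h : IsFlag k N s S) {d : ℕ → ℕ} (hd : Antitone d) {v : V} {i : ℕ}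
    (hi : v ∈ S i) (hi' : v ∉ S (i + 1)) (hdi : d (i + 1) < d i) :
    Nat.card {E : Submodule k[X] V //
        (∀ i, dm k (S i ⊓ E : Submodule k[X] V) = d i) ∧ v ∈ E}
      = flagCount k (fun j => (S j).map (Submodule.span k[X] {v}).mkQ)
        (fun j => d j - if j ≤ i then 1 else 0) := by
  have hmem (E : {E : Submodule k[X] (V ⧸ Submodule.span k[X] {v}) // ∀ j,
      dm k ((S j).map (Submodule.span k[X] {v}).mkQ ⊓ E : Submodule k[X] _)
        = d j - if j ≤ i then 1 else 0}) :
      (∀ j, dm k (S j ⊓ E.1.comap (Submodule.span k[X] {v}).mkQ : Submodule k[X] V) = d j) ∧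
        v ∈ E.1.comap (Submodule.span k[X] {v}).mkQ := by
    refine ⟨fun j => ?_, Submodule.le_comap_mkQ _ _ (Submodule.mem_span_singleton_self v)⟩
    rw [h.dm_map_inf hi hi', E.2 j]
    split_ifs with hj
    · have := hd hj
      omega
    · omega
  refine (Nat.card_congr (Equiv.ofBijective (fun E => ⟨_, hmem E⟩) ⟨?_, ?_⟩)).symm
  · intro E E' hE
    exact Subtype.ext (Submodule.comap_injective_of_surjective (Submodule.mkQ_surjective _)
      (congrArg Subtype.val hE))
  · rintro ⟨E, hE, hv⟩
    have hle : Submodule.span k[X] {v} ≤ E := (Submodule.span_singleton_le_iff_mem _ _).2 hv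
    have hc : (E.map (Submodule.span k[X] {v}).mkQ).comap (Submodule.span k[X] {v}).mkQ = E := by
      rw [Submodule.comap_map_mkQ, sup_eq_right.2 hle]
    refine ⟨⟨E.map (Submodule.span k[X] {v}).mkQ, fun j => ?_⟩, Subtype.ext hc⟩
    have h1 := h.dm_map_inf hi hi' (E.map (Submodule.span k[X] {v}).mkQ) j
    rw [hc, hE] at h1
    exact (Nat.sub_eq_of_eq_add' h1).symm

theorem IsFlag.flagCount_mul (h : IsFlag k N s S) {d : ℕ → ℕ} (hd : Antitone d) {i : ℕ}
    (hdi : d (i + 1) < d i) (m : ℤ)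
    (hm : ∀ v ∈ S i, v ∉ S (i + 1) → (flagCount k
      (fun j => (S j).map (Submodule.span k[X] {v}).mkQ)
        (fun j => d j - if j ≤ i then 1 else 0) : ℤ) = m) :
    ((Nat.card k : ℤ) ^ d i - (Nat.card k : ℤ) ^ d (i + 1)) * flagCount k S d
      = ((Nat.card k : ℤ) ^ s i - (Nat.card k : ℤ) ^ s (i + 1)) * m := by
  classical
  have := Fintype.ofFinite V
  have := Fintype.ofFinite (Submodule k[X] V)
  have key := Finset.sum_card_bipartiteAbove_eq_sum_card_bipartiteBelow
    (s := Finset.univ.filter fun v : V => v ∈ S i ∧ v ∉ S (i + 1))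
    (t := Finset.univ.filter fun E : Submodule k[X] V =>
      ∀ i, dm k (S i ⊓ E : Submodule k[X] V) = d i) (fun v E => v ∈ E)
  have h1 : ∀ v ∈ Finset.univ.filter fun v : V => v ∈ S i ∧ v ∉ S (i + 1),
      ((Finset.bipartiteAbove (fun v E => v ∈ E) (Finset.univ.filter
        fun E : Submodule k[X] V => ∀ i, dm k (S i ⊓ E : Submodule k[X] V) = d i) v).card : ℤ)
        = m := by
    intro v hv
    rw [Finset.mem_filter] at hv
    rw [← hm v hv.2.1 hv.2.2, ← h.card_mem hd hv.2.1 hv.2.2 hdi, Nat.card_eq_fintype_card,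
      Fintype.card_subtype, Finset.bipartiteAbove, Finset.filter_filter]
  have h2 : ∀ E ∈ Finset.univ.filter fun E : Submodule k[X] V =>
      ∀ i, dm k (S i ⊓ E : Submodule k[X] V) = d i,
      ((Finset.bipartiteBelow (fun v E => v ∈ E)
        (Finset.univ.filter fun v : V => v ∈ S i ∧ v ∉ S (i + 1)) E).card : ℤ)
        = (Nat.card k : ℤ) ^ d i - (Nat.card k : ℤ) ^ d (i + 1) := by
    intro E hE
    rw [Finset.mem_filter] at hE
    rw [← hE.2, ← hE.2, ← ncard_diff (inf_le_inf_right E (h.anti (Nat.le_add_right i 1))),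
      ← Set.ncard_coe_finset]
    congr 2
    ext v
    simp [Finset.bipartiteBelow]
    tauto
  have key' := congrArg (Nat.cast : ℕ → ℤ) key
  rw [Nat.cast_sum, Nat.cast_sum, Finset.sum_congr rfl h1, Finset.sum_congr rfl h2,
    Finset.sum_const, Finset.sum_const, nsmul_eq_mul, nsmul_eq_mul] at key'
  rw [← h.dim, ← h.dim, ← ncard_diff (h.anti (Nat.le_add_right i 1)), mul_comm, flagCount,
    Nat.card_eq_fintype_card, Fintype.card_subtype, ← key', ← Set.ncard_coe_finset]
  simp

end Flags

/-- The number of submodules meeting the members of a flag in prescribed dimensions is a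
polynomial in the cardinality of the field. -/
theorem exists_flag_polynomial (N m : ℕ) (s d : ℕ → ℕ) (hm : d 0 = m)
    (hs : ∀ (k : Type) [Field k] [Finite k], ∃ (V : Type) (_ : AddCommGroup V)
      (_ : Module k[X] V) (_ : Finite V) (S : ℕ → Submodule k[X] V), IsFlag k N s S) :
    ∃ P : ℤ[X], ∀ (k : Type) [Field k] [Finite k] (V : Type) [AddCommGroup V] [Module k[X] V]
      [Finite V] (S : ℕ → Submodule k[X] V), IsFlag k N s S →
        (flagCount k S d : ℤ) = P.eval (Nat.card k : ℤ) := by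
  induction m generalizing s d with
  | zero =>
    by_cases hd : ∀ i, d i = 0
    · refine ⟨1, fun k _ _ V _ _ _ S h => ?_⟩
      rw [eval_one, flagCount, Nat.cast_eq_one, Nat.card_eq_one_iff_exists]
      refine ⟨⟨⊥, fun i => by rw [inf_bot_eq, dm_bot, hd]⟩, fun E => Subtype.ext ?_⟩
      apply eq_bot_of_dm_eq_zero (k := k)
      rw [← hm, ← E.2 0, h.top, top_inf_eq]
    · refine ⟨0, fun k _ _ V _ _ _ S h => ?_⟩
      rw [eval_zero, flagCount, Nat.cast_eq_zero]
      have : IsEmpty {E : Submodule k[X] V // ∀ i, dm k (S i ⊓ E : Submodule k[X] V) = d i} := by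
        refine ⟨fun E => hd fun i => ?_⟩
        have := dm_mono (k := k) (inf_le_inf_right E.1 (h.anti (Nat.zero_le i)))
        rw [E.2, E.2, hm] at this
        omega
      exact Nat.card_of_isEmpty
  | succ m ih =>
    by_cases hd : Antitone d ∧ d N = 0
    · obtain ⟨hd, hN⟩ := hd
      obtain ⟨i, hi⟩ : ∃ i, d (i + 1) < d i := by
        by_contra! hcon
        have : ∀ i, m + 1 ≤ d i := fun i => by
          induction i with
          | zero => omega
          | succ i ih' => exact ih'.trans (hcon i)
        have := this N
        omega
      by_cases hsi : s i = s (i + 1)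
      · refine ⟨0, fun k _ _ V _ _ _ S h => ?_⟩
        rw [eval_zero, flagCount, Nat.cast_eq_zero]
        have : IsEmpty {E : Submodule k[X] V //
            ∀ i, dm k (S i ⊓ E : Submodule k[X] V) = d i} := by
          refine ⟨fun E => ?_⟩
          have h1 := eq_of_dm_le (k := k) (h.anti (Nat.le_add_right i 1))
            (by rw [h.dim, h.dim, hsi])
          have h2 := E.2 i
          rw [← h1, E.2] at h2
          omega
        exact Nat.card_of_isEmpty
      · have hex : ∀ (k : Type) [Field k] [Finite k] (V : Type) [AddCommGroup V] [Module k[X] V]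
            [Finite V] (S : ℕ → Submodule k[X] V), IsFlag k N s S →
              ∃ v, v ∈ S i ∧ v ∉ S (i + 1) := by
          intro k _ _ V _ _ _ S h
          by_contra! hcon
          exact hsi (by rw [← h.dim, ← h.dim, le_antisymm hcon (h.anti (Nat.le_add_right i 1))])
        obtain ⟨Q, hQ⟩ := ih (fun j => s j - if j ≤ i then 1 else 0)
          (fun j => d j - if j ≤ i then 1 else 0) (by simp [hm]) (by
            intro k _ _
            obtain ⟨V, _, _, _, S, h⟩ := hs k
            obtain ⟨v, hv, hv'⟩ := hex k V S h
            exact ⟨_, _, _, inferInstance, _, h.quotient hv hv'⟩)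
        have hmul : ∀ (k : Type) [Field k] [Finite k] (V : Type) [AddCommGroup V]
            [Module k[X] V] [Finite V] (S : ℕ → Submodule k[X] V), IsFlag k N s S →
            (X ^ d i - X ^ d (i + 1) : ℤ[X]).eval (Nat.card k : ℤ) * flagCount k S d
              = ((X ^ s i - X ^ s (i + 1)) * Q).eval (Nat.card k : ℤ) := by
          intro k _ _ V _ _ _ S h
          rw [eval_mul, eval_pow_sub_pow, eval_pow_sub_pow]
          exact h.flagCount_mul hd hi _ fun v hv hv' => hQ k _ _ (h.quotient hv hv')
        obtain ⟨P, hP⟩ := dvd_of_infinite_eval_dvd (monic_pow_sub_pow hi)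
          (B := (X ^ s i - X ^ s (i + 1)) * Q) (infinite_of_finite_fields fun k _ _ => by
            obtain ⟨V, _, _, _, S, h⟩ := hs k
            exact ⟨_, (hmul k V S h).symm⟩)
        refine ⟨P, fun k _ _ V _ _ _ S h => ?_⟩
        have h1 := hmul k V S h
        rw [hP, eval_mul] at h1
        refine mul_left_cancel₀ ?_ h1
        rw [eval_pow_sub_pow, sub_ne_zero]
        have := Nat.pow_lt_pow_right (one_lt_natCard k) hi
        exact_mod_cast this.ne'
    · refine ⟨0, fun k _ _ V _ _ _ S h => ?_⟩
      rw [eval_zero, flagCount, Nat.cast_eq_zero]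
      have : IsEmpty {E : Submodule k[X] V // ∀ i, dm k (S i ⊓ E : Submodule k[X] V) = d i} := by
        refine ⟨fun E => hd ⟨fun i j hij => ?_, ?_⟩⟩
        · rw [← E.2, ← E.2]
          exact dm_mono (inf_le_inf_right E.1 (h.anti hij))
        · rw [← E.2, h.bot, bot_inf_eq, dm_bot]
      exact Nat.card_of_isEmpty

section Classification

variable {k : Type} [Field k]

/-- The indecomposable nilpotent module `k[X] / (X ^ j)`. -/
abbrev Jord (k : Type) [Field k] (j : ℕ) : Type := k[X] ⧸ Ideal.span {(X : k[X]) ^ j}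

theorem natCard_jord (k : Type) [Field k] [Finite k] (j : ℕ) :
    Nat.card (Jord k j) = Nat.card k ^ j := by
  have h0 : (X ^ j : k[X]).Monic := monic_X_pow j
  have : Module.Finite k (Jord k j) := h0.finite_quotient
  rw [Module.natCard_eq_pow_finrank (K := k), finrank_quotient_span_eq_natDegree, natDegree_X_pow]

instance [Finite k] (j : ℕ) : Finite (Jord k j) :=
  Nat.finite_of_card_ne_zero (by
    rw [natCard_jord]
    exact pow_ne_zero _ (one_lt_natCard k).ne_bot)

theorem tp_jord [Finite k] (i j : ℕ) : tp k (Jord k j) i = j - i := by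
  apply dm_eq_of_natCard
  rw [← natCard_jord]
  let f : k[X] →ₗ[k[X]] Jord k j :=
    (LinearMap.lsmul k[X] (Jord k j) (X ^ i)) ∘ₗ (Ideal.span {(X : k[X]) ^ j}).mkQ
  have hr : LinearMap.range f = pw k (Jord k j) i := by
    rw [LinearMap.range_comp, Submodule.range_mkQ, Submodule.map_top]
    rfl
  have hk : LinearMap.ker f = Ideal.span {(X : k[X]) ^ (j - i)} := by
    ext p
    have h1 : f p = (Ideal.span {(X : k[X]) ^ j}).mkQ (X ^ i * p) := by
      simp only [f, LinearMap.comp_apply, LinearMap.lsmul_apply, ← map_smul, smul_eq_mul]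
    rw [LinearMap.mem_ker, h1, Submodule.mkQ_apply, Submodule.Quotient.mk_eq_zero,
      Ideal.mem_span_singleton, Ideal.mem_span_singleton, X_pow_dvd_iff, X_pow_dvd_iff]
    constructor
    · intro h d hd
      have := h (d + i) (by omega)
      rwa [coeff_X_pow_mul] at this
    · intro h d hd
      rw [coeff_X_pow_mul']
      split_ifs with hid
      · exact h _ (by omega)
      · rfl
  rw [← hr]
  exact (Nat.card_congr ((Submodule.quotEquivOfEq _ _ hk).symm.trans
    f.quotKerEquivRange).toEquiv).symm

theorem tp_pi [Finite k] {ι : Type} [Fintype ι] (M : ι → Type) [∀ j, AddCommGroup (M j)]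
    [∀ j, Module k[X] (M j)] [∀ j, Finite (M j)] (i : ℕ) :
    tp k (∀ j, M j) i = ∑ j, tp k (M j) i := by
  apply dm_eq_of_natCard
  rw [← Finset.prod_pow_eq_pow_sum]
  have h1 : ∀ j, Nat.card k ^ tp k (M j) i = Nat.card (pw k (M j) i) := fun j =>
    (natCard_eq k _).symm
  simp only [h1]
  rw [← Nat.card_pi]
  refine Nat.card_congr (Equiv.trans (Equiv.subtypeEquivRight fun f => ?_)
    (Equiv.subtypePiEquivPi (p := fun j x => x ∈ pw k (M j) i)))
  simp only [mem_pw]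
  constructor
  · rintro ⟨g, rfl⟩ j
    exact ⟨g j, rfl⟩
  · intro h
    choose g hg using h
    exact ⟨g, funext hg⟩

/-- A direct sum is the product of any finite family of its terms containing all nonzero ones. -/
theorem nonempty_directSum_equiv_pi {R ι : Type} [Semiring R] [DecidableEq ι] (M : ι → Type)
    [∀ i, AddCommMonoid (M i)] [∀ i, Module R (M i)] (s : Finset ι)
    (hs : ∀ i ∉ s, Subsingleton (M i)) :
    Nonempty (DirectSum ι M ≃ₗ[R] ∀ i : s, M i) := by
  refine ⟨(LinearEquiv.ofBijective (DirectSum.lmk R ι M s)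
    ⟨DirectSum.mk_injective (β := M) s, fun x => ⟨fun i => x i, ?_⟩⟩).symm⟩
  refine DFinsupp.ext fun i => ?_
  by_cases hi : i ∈ s
  · exact DFinsupp.mk_of_mem (β := M) (x := fun i => x i) hi
  · exact @Subsingleton.elim _ (hs i hi) _ _

theorem nonempty_imod_equiv_pi (k : Type) [Field k] (ν : ℕ →₀ ℕ) :
    Nonempty (Imod k ν ≃ₗ[k[X]] ∀ j : ν.support, Fin (ν j) → Jord k j) := by
  refine nonempty_directSum_equiv_pi (fun j => Fin (ν j) → Jord k j) ν.support fun j hj => ?_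
  rw [Finsupp.notMem_support_iff.1 hj]
  infer_instance

instance [Finite k] (ν : ℕ →₀ ℕ) : Finite (Imod k ν) :=
  Finite.of_equiv _ (nonempty_imod_equiv_pi k ν).some.symm.toEquiv

theorem tp_imod [Finite k] (ν : ℕ →₀ ℕ) (i : ℕ) :
    tp k (Imod k ν) i = ν.sum fun j c => c * (j - i) := by
  rw [tp_congr (nonempty_imod_equiv_pi k ν).some, tp_pi]
  simp only [tp_pi, tp_jord, Finset.sum_const, Finset.card_univ, Fintype.card_fin, smul_eq_mul]
  exact Finset.sum_coe_sort ν.support fun j => ν j * (j - i)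

theorem tp_imod_eventually_zero [Finite k] (ν : ℕ →₀ ℕ) :
    tp k (Imod k ν) (ν.support.sup id) = 0 := by
  rw [tp_imod]
  refine Finset.sum_eq_zero fun j hj => ?_
  have := Finset.le_sup (f := id) hj
  exact mul_eq_zero_of_right _ (Nat.sub_eq_zero_of_le this)

theorem second_difference (ν : ℕ →₀ ℕ) (i : ℕ) :
    (ν.sum fun j c => c * (j - i)) + (ν.sum fun j c => c * (j - (i + 2)))
      = 2 * (ν.sum fun j c => c * (j - (i + 1))) + ν (i + 1) := by
  have h1 : ν (i + 1) = ν.sum fun j c => if j = i + 1 then c else 0 := by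
    rw [Finsupp.sum_ite_eq' ν (i + 1) fun _ c => c]
    split_ifs with h
    · rfl
    · exact Finsupp.notMem_support_iff.1 h
  rw [h1]
  simp only [Finsupp.sum, Finset.mul_sum, ← Finset.sum_add_distrib]
  refine Finset.sum_congr rfl fun j _ => ?_
  split_ifs with h
  · subst h
    simp
  · rcases Nat.lt_or_ge i j with hij | hij
    · obtain ⟨c, rfl⟩ := Nat.exists_eq_add_of_le (show i + 2 ≤ j by omega)
      rw [show i + 2 + c - i = c + 2 by omega, show i + 2 + c - (i + 2) = c by omega,
        show i + 2 + c - (i + 1) = c + 1 by omega]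
      ring
    · rw [show j - i = 0 by omega, show j - (i + 2) = 0 by omega,
        show j - (i + 1) = 0 by omega]
      simp

theorem eq_of_tp_imod_eq [Finite k] {μ ν : ℕ →₀ ℕ} (hμ : μ 0 = 0) (hν : ν 0 = 0)
    (h : tp k (Imod k μ) = tp k (Imod k ν)) : μ = ν := by
  ext j
  rcases j with _ | i
  · rw [hμ, hν]
  · have h1 := second_difference μ i
    have h2 := second_difference ν i
    simp only [← tp_imod (k := k)] at h1 h2
    rw [h] at h1
    omega

theorem exists_equiv_imod [Finite k] {M : Type} [AddCommGroup M] [Module k[X] M] [Finite M]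
    {N : ℕ} (hN : tp k M N = 0) : ∃ ν : ℕ →₀ ℕ, ν 0 = 0 ∧ Nonempty (M ≃ₗ[k[X]] Imod k ν) := by
  classical
  have htor : Module.IsTorsion' M (Submonoid.powers (X : k[X])) := by
    intro x
    refine ⟨⟨X ^ N, N, rfl⟩, ?_⟩
    have h0 : (X ^ N : k[X]) • x ∈ pw k M N := ⟨x, rfl⟩
    rw [eq_bot_of_dm_eq_zero hN] at h0
    exact (Submodule.mem_bot _).1 h0
  have hfin : Module.Finite k[X] M := Module.Finite.of_finite
  obtain ⟨d, p, ⟨e⟩⟩ := Module.torsion_by_prime_power_decomposition irreducible_X htor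
  let s : Finset (Fin d) := Finset.univ.filter fun i => p i ≠ 0
  obtain ⟨e'⟩ := nonempty_directSum_equiv_pi (R := k[X])
    (fun i => Jord k (p i)) s (fun i hi => by
      have : p i = 0 := by simpa [s] using hi
      rw [this]
      refine Submodule.Quotient.subsingleton_iff.2 ?_
      simp)
  let ν : ℕ →₀ ℕ := Finsupp.onFinset (s.image p) (fun j => (s.filter fun i => p i = j).card)
    (fun j hj => by
      obtain ⟨i, hi⟩ := Finset.card_ne_zero.1 hj
      rw [Finset.mem_filter] at hi
      exact Finset.mem_image.2 ⟨i, hi⟩)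
  have hν0 : ν 0 = 0 := by
    simp only [ν, Finsupp.onFinset_apply, Finset.card_eq_zero]
    ext i
    simp [s]
  refine ⟨ν, hν0, ?_⟩
  obtain ⟨e''⟩ := nonempty_imod_equiv_pi k ν
  have hE (j : ℕ) : Nonempty (Fin (ν j) ≃ {i : s // p i = j}) := by
    refine ⟨(Fintype.equivFinOfCardEq ?_).symm⟩
    rw [Fintype.card_subtype]
    simp only [ν, Finsupp.onFinset_apply]
    rw [← Finset.card_map (Function.Embedding.subtype _)]
    congr 1
    ext i
    simp [and_comm]
  have hsupp : ∀ i : s, p i ∈ ν.support := by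
    rintro ⟨i, hi⟩
    rw [Finsupp.mem_support_iff]
    simp only [ν, Finsupp.onFinset_apply]
    exact Finset.card_ne_zero.2 ⟨i, Finset.mem_filter.2 ⟨hi, rfl⟩⟩
  let q : s → ν.support := fun i => ⟨p i, hsupp i⟩
  let E : (Σ j : ν.support, Fin (ν j)) ≃ s :=
    (Equiv.sigmaCongrRight fun j : ν.support => (hE j).some.trans
      (Equiv.subtypeEquivRight (q := fun i => q i = j) fun i =>
        (Subtype.ext_iff : q i = j ↔ p i = j).symm)).trans
      (Equiv.sigmaFiberEquiv q)
  have hEp (x) : p (E x) = x.1 := by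
    obtain ⟨j, t⟩ := x
    exact ((hE j).some t).2
  let e₁ : (∀ x, Jord k (p (E x))) ≃ₗ[k[X]] ∀ i : s, Jord k (p i) :=
    LinearEquiv.piCongrLeft k[X] (fun i : s => Jord k (p i)) E
  let e₂ : (∀ x : (Σ j : ν.support, Fin (ν j)), Jord k (p (E x))) ≃ₗ[k[X]]
      ∀ x : (Σ j : ν.support, Fin (ν j)), Jord k x.1 :=
    LinearEquiv.piCongrRight fun x => Submodule.quotEquivOfEq _ _ (by rw [hEp])
  let e₃ := LinearEquiv.piCurry k[X] (fun (j : ν.support) (_ : Fin (ν j)) => Jord k j)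
  exact ⟨e.trans (e'.trans (e₁.symm.trans (e₂.trans (e₃.trans e''.symm))))⟩

theorem nonempty_equiv_imod_iff [Finite k] {M : Type} [AddCommGroup M] [Module k[X] M] [Finite M]
    {ν : ℕ →₀ ℕ} (hν : ν 0 = 0) :
    Nonempty (M ≃ₗ[k[X]] Imod k ν) ↔ tp k M = tp k (Imod k ν) := by
  refine ⟨fun ⟨e⟩ => tp_congr e, fun h => ?_⟩
  obtain ⟨μ, hμ, ⟨e⟩⟩ := exists_equiv_imod (k := k) (M := M)
    (h ▸ tp_imod_eventually_zero ν)
  rw [tp_congr e] at h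
  rw [← eq_of_tp_imod_eq hμ hν h]
  exact ⟨e⟩

/-- A type of nilpotent modules which occurs over one finite field occurs over all of them. -/
theorem exists_tp_eq [Finite k] {M : Type} [AddCommGroup M] [Module k[X] M] [Finite M]
    {N : ℕ} (hN : tp k M N = 0) (l : Type) [Field l] [Finite l] :
    ∃ (M' : Type) (_ : AddCommGroup M') (_ : Module l[X] M') (_ : Finite M'),
      tp l M' = tp k M := by
  obtain ⟨ν, -, ⟨e⟩⟩ := exists_equiv_imod hN
  refine ⟨Imod l ν, inferInstance, inferInstance, inferInstance, ?_⟩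
  ext i
  rw [tp_congr e, tp_imod, tp_imod]

end Classification

section Submodules

variable {k : Type} [Field k] {M : Type} [AddCommGroup M] [Module k[X] M]

theorem dm_map_subtype (L : Submodule k[X] M) (E : Submodule k[X] L) :
    dm k (E.map L.subtype) = dm k E :=
  dm_congr (Submodule.equivSubtypeMap L E).symm.toEquiv

theorem tp_quotient_map_mkQ {E L : Submodule k[X] M} (h : E ≤ L) :
    tp k ((M ⧸ E) ⧸ L.map E.mkQ) = tp k (M ⧸ L) :=
  tp_congr (Submodule.quotientQuotientEquivQuotient E L h)

theorem tp_map_mkQ_map_subtype (L : Submodule k[X] M) (E : Submodule k[X] L) :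
    tp k (L.map (E.map L.subtype).mkQ) = tp k (L ⧸ E) := by
  let f : L →ₗ[k[X]] M ⧸ E.map L.subtype := (E.map L.subtype).mkQ ∘ₗ L.subtype
  have hker : E = LinearMap.ker f := by
    rw [LinearMap.ker_comp, Submodule.ker_mkQ,
      Submodule.comap_map_eq_of_injective L.subtype_injective]
  have hrange : LinearMap.range f = L.map (E.map L.subtype).mkQ := by
    rw [LinearMap.range_comp, Submodule.range_subtype]
  exact (tp_congr ((Submodule.quotEquivOfEq _ _ hker).trans
    (f.quotKerEquivRange.trans (LinearEquiv.ofEq _ _ hrange)))).symm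

theorem map_subtype_le_kx {L : Submodule k[X] M} {E : Submodule k[X] L} :
    E.map L.subtype ≤ kx k M ↔ E ≤ kx k L := by
  rw [Submodule.map_le_iff_le_comap]
  refine forall₂_congr fun x _ => ?_
  simp only [Submodule.mem_comap, mem_kx, Subtype.ext_iff]
  rfl

variable [Finite k] [Finite M]

theorem isFlag_kx {N : ℕ} (hN : tp k M N = 0) :
    IsFlag k N (fun i => tp k M i - tp k M (i + 1))
      (fun i => (pw k M i).comap (kx k M).subtype) where
  smul := fun v => Subtype.ext v.2
  anti := fun _ _ hij => Submodule.comap_mono (pw_antitone hij)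
  top := by rw [pw_zero, Submodule.comap_top]
  bot := by rw [eq_bot_of_dm_eq_zero hN, Submodule.comap_bot, Submodule.ker_subtype]
  dim := by
    intro i
    rw [← dm_map_subtype, Submodule.map_comap_subtype, inf_comm]
    have := tp_eq_add_tp_succ (k := k) (M := M) i
    omega

theorem natCard_socle_submodule {κ : ℕ → ℕ} (hκ : κ ≤ tp k M) :
    Nat.card {E : Submodule k[X] M // E ≤ kx k M ∧ tp k (M ⧸ E) = κ}
      = flagCount k (fun i => (pw k M i).comap (kx k M).subtype)
        (fun i => tp k M i - κ i) := by
  have key (E : Submodule k[X] (kx k M)) :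
      (∀ i, dm k ((pw k M i).comap (kx k M).subtype ⊓ E : Submodule k[X] (kx k M))
        = tp k M i - κ i) ↔ tp k (M ⧸ E.map (kx k M).subtype) = κ := by
    rw [funext_iff]
    refine forall_congr' fun i => ?_
    have h1 := tp_eq_add_tp_quotient (E.map (kx k M).subtype) i
    rw [inf_comm, Submodule.map_inf_eq_map_inf_comap, dm_map_subtype, inf_comm] at h1
    have h2 : κ i ≤ tp k M i := hκ i
    omega
  refine (Nat.card_congr (Equiv.ofBijective (fun E => ⟨E.1.map (kx k M).subtype,
    Submodule.map_subtype_le _ _, (key E).1 E.2⟩) ⟨?_, ?_⟩)).symm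
  · intro E E' h
    exact Subtype.ext (Submodule.map_injective_of_injective (kx k M).subtype_injective
      (congrArg Subtype.val h))
  · rintro ⟨E, hE, ht⟩
    have h : (E.comap (kx k M).subtype).map (kx k M).subtype = E := by
      rw [Submodule.map_comap_subtype, inf_eq_right.2 hE]
    exact ⟨⟨E.comap (kx k M).subtype, (key _).2 (by rw [h, ht])⟩, Subtype.ext h⟩

end Submodules

theorem exists_socle_polynomial (n κ : ℕ → ℕ) {N : ℕ} (hN : n N = 0) :
    ∃ P : ℤ[X], ∀ (k : Type) [Field k] [Finite k] (M : Type) [AddCommGroup M] [Module k[X] M]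
      [Finite M], tp k M = n →
        (Nat.card {E : Submodule k[X] M // E ≤ kx k M ∧ tp k (M ⧸ E) = κ} : ℤ)
          = P.eval (Nat.card k : ℤ) := by
  by_cases hn : κ ≤ n ∧ ∀ (k : Type) [Field k] [Finite k], ∃ (M : Type) (_ : AddCommGroup M)
      (_ : Module k[X] M) (_ : Finite M), tp k M = n
  · obtain ⟨hκ, hn⟩ := hn
    obtain ⟨P, hP⟩ := exists_flag_polynomial N _ (fun i => n i - n (i + 1))
      (fun i => n i - κ i) rfl (by
        intro k _ _
        obtain ⟨M, _, _, _, rfl⟩ := hn k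
        exact ⟨_, _, _, inferInstance, _, isFlag_kx hN⟩)
    refine ⟨P, fun k _ _ M _ _ _ h => ?_⟩
    subst h
    rw [natCard_socle_submodule hκ]
    exact hP k _ _ (isFlag_kx hN)
  · refine ⟨0, fun k _ _ M _ _ _ h => ?_⟩
    subst h
    rw [eval_zero, Nat.cast_eq_zero]
    have : IsEmpty {E : Submodule k[X] M // E ≤ kx k M ∧ tp k (M ⧸ E) = κ} := by
      refine ⟨fun E => hn ⟨?_, fun l _ _ => exists_tp_eq hN l⟩⟩
      rw [← E.2.2]
      exact tp_quotient_le E.1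
    exact Nat.card_of_isEmpty

/-- The number of submodules of `M` of type `a` and cotype `b`. -/
noncomputable def hallCount (k : Type) [Field k] (M : Type) [AddCommGroup M] [Module k[X] M]
    (a b : ℕ → ℕ) : ℕ :=
  Nat.card {L : Submodule k[X] M // tp k L = a ∧ tp k (M ⧸ L) = b}

/-- The number of submodules `E` of `L` killed by `X` of dimension `r` and cotype `a`. -/
noncomputable def socleCount (k : Type) [Field k] (L : Type) [AddCommGroup L] [Module k[X] L]
    (r : ℕ) (a : ℕ → ℕ) : ℕ :=
  Nat.card {E : Submodule k[X] L // (E ≤ kx k L ∧ dm k E = r) ∧ tp k (L ⧸ E) = a}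

section DoubleCounting

variable {k : Type} [Field k] {M : Type} [AddCommGroup M] [Module k[X] M]

theorem hallCount_quotient (E : Submodule k[X] M) (a b : ℕ → ℕ) :
    Nat.card {L : Submodule k[X] M // tp k (M ⧸ L) = b ∧ E ≤ L ∧ tp k (L.map E.mkQ) = a}
      = hallCount k (M ⧸ E) a b := by
  refine Nat.card_congr (Equiv.ofBijective (fun L => ⟨L.1.map E.mkQ, L.2.2.2,
    (tp_quotient_map_mkQ L.2.2.1).trans L.2.1⟩) ⟨?_, ?_⟩)
  · rintro ⟨L, _, h, _⟩ ⟨L', _, h', _⟩ hL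
    have := congrArg (Submodule.comap E.mkQ) (congrArg Subtype.val hL)
    simp only [Submodule.comap_map_mkQ, sup_eq_right.2 h, sup_eq_right.2 h'] at this
    exact Subtype.ext this
  · rintro ⟨L, h, h'⟩
    have hle : E ≤ L.comap E.mkQ := Submodule.le_comap_mkQ E L
    have hL : (L.comap E.mkQ).map E.mkQ = L :=
      Submodule.map_comap_eq_of_surjective E.mkQ_surjective L
    refine ⟨⟨L.comap E.mkQ, ?_, hle, ?_⟩, Subtype.ext hL⟩
    · rw [← tp_quotient_map_mkQ hle, hL, h']
    · rw [hL, h]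

theorem socleCount_submodule (L : Submodule k[X] M) (r : ℕ) (a : ℕ → ℕ) :
    Nat.card {E : Submodule k[X] M //
        (E ≤ kx k M ∧ dm k E = r) ∧ E ≤ L ∧ tp k (L.map E.mkQ) = a}
      = socleCount k L r a := by
  refine (Nat.card_congr (Equiv.ofBijective (fun E => ⟨E.1.map L.subtype,
    ⟨map_subtype_le_kx.2 E.2.1.1, (dm_map_subtype L E.1).trans E.2.1.2⟩,
    Submodule.map_subtype_le _ _, (tp_map_mkQ_map_subtype L E.1).trans E.2.2⟩) ⟨?_, ?_⟩)).symm
  · intro E E' h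
    exact Subtype.ext (Submodule.map_injective_of_injective L.subtype_injective
      (congrArg Subtype.val h))
  · rintro ⟨E, ⟨h1, h2⟩, h3, h4⟩
    obtain ⟨E, rfl⟩ : ∃ E' : Submodule k[X] L, E'.map L.subtype = E :=
      ⟨E.comap L.subtype, by rw [Submodule.map_comap_subtype, inf_eq_right.2 h3]⟩
    exact ⟨⟨E, ⟨map_subtype_le_kx.1 h1, (dm_map_subtype L E).symm.trans h2⟩,
      (tp_map_mkQ_map_subtype L E).symm.trans h4⟩, rfl⟩

open Classical in
theorem sum_hallCount_quotient [Fintype (Submodule k[X] M)] (r : ℕ) (a b : ℕ → ℕ) :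
    ∑ E : Submodule k[X] M with E ≤ kx k M ∧ dm k E = r, hallCount k (M ⧸ E) a b
      = ∑ L : Submodule k[X] M with tp k (M ⧸ L) = b, socleCount k L r a := by
  have key := Finset.sum_card_bipartiteAbove_eq_sum_card_bipartiteBelow
    (s := Finset.univ.filter fun E : Submodule k[X] M => E ≤ kx k M ∧ dm k E = r)
    (t := Finset.univ.filter fun L : Submodule k[X] M => tp k (M ⧸ L) = b)
    (fun E L => E ≤ L ∧ tp k (L.map E.mkQ) = a)
  convert key using 2 with E _ L _
  · rw [← hallCount_quotient, Nat.card_eq_fintype_card, Fintype.card_subtype,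
      Finset.bipartiteAbove, Finset.filter_filter]
  · rw [← socleCount_submodule, Nat.card_eq_fintype_card, Fintype.card_subtype,
      Finset.bipartiteBelow, Finset.filter_filter]

variable [Finite k] [Finite M] {r : ℕ} {a : ℕ → ℕ}

/-- The only submodule of `M` killed by `X` and of dimension that of the kernel is the kernel. -/
theorem socleCount_eq_one (ha : tp k M = a) (hr : a 0 = r + a 1) :
    socleCount k M r (fun i => a (i + 1)) = 1 := by
  subst ha
  have hd : dm k (kx k M) = r := by
    have := dm_kx (k := k) (M := M)
    omega
  rw [socleCount, Nat.card_eq_one_iff_exists]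
  refine ⟨⟨kx k M, ⟨le_rfl, hd⟩, ?_⟩, ?_⟩
  · ext i
    have h1 := tp_eq_add_tp_quotient (kx k M) i
    have h2 := tp_eq_add_tp_succ (k := k) (M := M) i
    omega
  · rintro ⟨E, ⟨h1, h2⟩, h3⟩
    exact Subtype.ext (eq_of_dm_le h1 (by rw [h2, hd]))

theorem lt_of_socleCount_ne_zero (h0 : tp k M 0 = a 0) (hr : a 0 = r + a 1) (ha : tp k M ≠ a)
    (h : socleCount k M r (fun i => a (i + 1)) ≠ 0) : tp k M 1 < a 1 := by
  obtain ⟨⟨E, ⟨h1, h2⟩, h3⟩⟩ := (Nat.card_ne_zero.1 h).1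
  have h4 := dm_kx (k := k) (M := M)
  have h5 := dm_mono h1
  refine lt_of_le_of_ne (by omega) fun h6 => ha ?_
  have h7 : E = kx k M := eq_of_dm_le h1 (by omega)
  subst h7
  ext i
  rcases i with _ | i
  · exact h0
  · have h8 := tp_eq_add_tp_quotient (kx k M) i
    have h9 := tp_eq_add_tp_succ (k := k) (M := M) i
    have h10 := congrFun h3 i
    omega

theorem socleCount_eq (h0 : tp k M 0 = r + a 0) :
    socleCount k M r a = Nat.card {E : Submodule k[X] M // E ≤ kx k M ∧ tp k (M ⧸ E) = a} := by
  refine Nat.card_congr (Equiv.subtypeEquivRight fun E => ?_)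
  refine ⟨fun h => ⟨h.1.1, h.2⟩, fun h => ⟨⟨h.1, ?_⟩, h.2⟩⟩
  have h1 := tp_eq_add_tp_quotient E 0
  rw [pw_zero, top_inf_eq, h.2] at h1
  omega

theorem tp_zero_eq_add (L : Submodule k[X] M) : tp k M 0 = tp k L 0 + tp k (M ⧸ L) 0 := by
  rw [tp_zero, tp_zero, tp_zero, ← dm_quotient]

end DoubleCounting

theorem finite_Iic_type {n : ℕ → ℕ} {N : ℕ} (hN : ∀ i, N ≤ i → n i = 0) :
    {κ : ℕ → ℕ | κ ≤ n}.Finite := by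
  have h : {κ : ℕ → ℕ | κ ≤ n} = Set.pi Set.univ fun i => Set.Iic (n i) := by
    ext κ
    simp [Pi.le_def]
  let n' : ℕ →₀ ℕ := Finsupp.onFinset (Finset.range N) n fun i hi => by
    by_contra hcon
    exact hi (hN i (by simpa using hcon))
  refine ((Set.finite_Iic n').image fun f : ℕ →₀ ℕ => (f : ℕ → ℕ)).subset fun κ hκ => ?_
  refine ⟨Finsupp.onFinset (Finset.range N) κ fun i hi => ?_, fun i => hκ i, rfl⟩
  by_contra hcon
  have := hκ i
  rw [hN i (by simpa using hcon)] at this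
  exact hi (Nat.le_zero.1 this)

theorem hallCount_eq_sum_sub_sum {k : Type} [Field k] [Finite k] {M : Type} [AddCommGroup M]
    [Module k[X] M] [Finite M] {a b : ℕ → ℕ} {r : ℕ} (hr : a 0 = r + a 1)
    (hab : tp k M 0 = a 0 + b 0) (ha : a ≤ tp k M) {T : Finset (ℕ → ℕ)}
    (hT : ∀ κ, κ ∈ T ↔ κ ≤ tp k M) {P Q R S : (ℕ → ℕ) → ℤ}
    (hP : ∀ E : Submodule k[X] M, tp k M 0 = r + tp k (M ⧸ E) 0 →
      (hallCount k (M ⧸ E) (fun i => a (i + 1)) b : ℤ) = P (tp k (M ⧸ E)))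
    (hQ : ∀ κ, (Nat.card {E : Submodule k[X] M // E ≤ kx k M ∧ tp k (M ⧸ E) = κ} : ℤ) = Q κ)
    (hR : ∀ c, c 1 < a 1 → (hallCount k M c b : ℤ) = R c)
    (hS : ∀ L : Submodule k[X] M, (Nat.card {E : Submodule k[X] L //
      E ≤ kx k L ∧ tp k (L ⧸ E) = fun i => a (i + 1)} : ℤ) = S (tp k L)) :
    (hallCount k M a b : ℤ) = ∑ κ ∈ T with tp k M 0 = r + κ 0, Q κ * P κ
      - ∑ c ∈ T with c 0 = a 0 ∧ c 1 < a 1, R c * S c := by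
  classical
  have := Fintype.ofFinite (Submodule k[X] M)
  have key := congrArg (Nat.cast : ℕ → ℤ)
    (sum_hallCount_quotient (k := k) (M := M) r (fun i => a (i + 1)) b)
  push_cast at key
  rw [← Finset.sum_fiberwise_of_maps_to (t := T.filter fun κ => tp k M 0 = r + κ 0)
      (g := fun E => tp k (M ⧸ E)) (by
        intro E hE
        rw [Finset.mem_filter] at hE ⊢
        refine ⟨(hT _).2 (tp_quotient_le E), ?_⟩
        rw [tp_zero_eq_add E, tp_zero, hE.2.2]),
    ← Finset.sum_fiberwise_of_maps_to (t := T) (g := fun L : Submodule k[X] M => tp k L) (by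
        intro L _
        exact (hT _).2 (tp_submodule_le L))] at key
  have hleft (κ : ℕ → ℕ) (hκ : κ ∈ T.filter fun κ => tp k M 0 = r + κ 0) :
      ∑ E ∈ Finset.univ.filter (fun E : Submodule k[X] M => E ≤ kx k M ∧ dm k E = r) with
        tp k (M ⧸ E) = κ, (hallCount k (M ⧸ E) (fun i => a (i + 1)) b : ℤ) = Q κ * P κ := by
    rw [Finset.mem_filter] at hκ
    rw [Finset.sum_congr rfl (g := fun _ => P κ), Finset.sum_const, nsmul_eq_mul, ← hQ,
      ← socleCount_eq hκ.2, Finset.filter_filter]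
    · rw [socleCount, ← Nat.subtype_card _ fun E => by rw [Finset.mem_filter_univ]]
    · intro E hE
      obtain rfl := (Finset.mem_filter.1 hE).2
      exact hP E hκ.2
  have hcard (c : ℕ → ℕ) : (hallCount k M c b : ℤ) = ((Finset.univ.filter
      fun L : Submodule k[X] M => tp k (M ⧸ L) = b).filter
        fun L : Submodule k[X] M => tp k L = c).card := by
    rw [hallCount, Finset.filter_filter,
      ← Nat.subtype_card _ fun L => by rw [Finset.mem_filter_univ, and_comm]]
  have hright (c : ℕ → ℕ) :
      ∑ L ∈ (Finset.univ.filter fun L : Submodule k[X] M => tp k (M ⧸ L) = b).filter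
        fun L : Submodule k[X] M => tp k L = c, (socleCount k L r (fun i => a (i + 1)) : ℤ)
      = (if c = a then (hallCount k M a b : ℤ) else 0)
        + if c 0 = a 0 ∧ c 1 < a 1 then R c * S c else 0 := by
    have h0 {L : Submodule k[X] M} (hL : L ∈ (Finset.univ.filter
        fun L : Submodule k[X] M => tp k (M ⧸ L) = b).filter
        fun L : Submodule k[X] M => tp k L = c) :
        tp k L = c ∧ tp k L 0 = a 0 := by
      rw [Finset.mem_filter, Finset.mem_filter] at hL
      have := tp_zero_eq_add L
      rw [hL.1.2] at this
      exact ⟨hL.2, by omega⟩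
    by_cases hc : c = a
    · subst hc
      rw [if_pos rfl, if_neg (by omega), add_zero, hcard, Finset.card_eq_sum_ones, Nat.cast_sum]
      refine Finset.sum_congr rfl fun L hL => ?_
      rw [socleCount_eq_one (h0 hL).1 hr]
    · rw [if_neg hc, zero_add]
      split_ifs with hc'
      · rw [← hR c hc'.2, hcard, ← nsmul_eq_mul, ← Finset.sum_const]
        refine Finset.sum_congr rfl fun L hL => ?_
        rw [socleCount_eq ((h0 hL).2.trans hr), hS, (h0 hL).1]
      · refine Finset.sum_eq_zero fun L hL => ?_
        obtain ⟨rfl, h1⟩ := h0 hL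
        rw [Nat.cast_eq_zero]
        by_contra h
        exact hc' ⟨h1, lt_of_socleCount_ne_zero h1 hr hc h⟩
  rw [Finset.sum_congr rfl hleft, Finset.sum_congr rfl fun c _ => hright c,
    Finset.sum_add_distrib, Finset.sum_ite_eq', if_pos ((hT a).2 ha), ← Finset.sum_filter] at key
  rw [key, add_sub_cancel_right]

theorem tp_bot {k : Type} [Field k] [Finite k] {M : Type} [AddCommGroup M] [Module k[X] M] :
    tp k (⊥ : Submodule k[X] M) = 0 :=
  funext fun _ => dm_eq_of_natCard (by simp)

theorem exists_hall_polynomial {N : ℕ} (n a b : ℕ → ℕ) (hN : ∀ i, N ≤ i → n i = 0) :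
    ∃ P : ℤ[X], ∀ (k : Type) [Field k] [Finite k] (M : Type) [AddCommGroup M] [Module k[X] M]
      [Finite M], tp k M = n → (hallCount k M a b : ℤ) = P.eval (Nat.card k : ℤ) := by
  induction hm : n 0 using Nat.strong_induction_on generalizing n a b with
  | _ m ih =>
  subst hm
  induction ht : a 1 using Nat.strong_induction_on generalizing a with
  | _ t ih' =>
  subst ht
  have hzero (h : ∀ (k : Type) [Field k] [Finite k] (M : Type) [AddCommGroup M] [Module k[X] M]
      [Finite M], tp k M = n → ∀ L : Submodule k[X] M, tp k L = a → tp k (M ⧸ L) ≠ b) :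
      ∃ P : ℤ[X], ∀ (k : Type) [Field k] [Finite k] (M : Type) [AddCommGroup M] [Module k[X] M]
        [Finite M], tp k M = n → (hallCount k M a b : ℤ) = P.eval (Nat.card k : ℤ) := by
    refine ⟨0, fun k _ _ M _ _ _ hM => ?_⟩
    rw [eval_zero, Nat.cast_eq_zero]
    exact Nat.card_eq_zero.2 (Or.inl ⟨fun L => h k M hM L.1 L.2.1 L.2.2⟩)
  by_cases ha : a ≤ n
  swap
  · refine hzero fun k _ _ M _ _ _ hM L hL _ => ha ?_
    rw [← hL, ← hM]
    exact tp_submodule_le L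
  by_cases hab : n 0 = a 0 + b 0
  swap
  · refine hzero fun k _ _ M _ _ _ hM L hL hL' => hab ?_
    rw [← hL, ← hL', ← hM, tp_zero_eq_add L]
  have hle {c : ℕ → ℕ} (hc : c ≤ n) : ∀ i, N ≤ i → c i = 0 := fun i hi =>
    Nat.le_zero.1 ((hc i).trans_eq (hN i hi))
  have haN : a N = 0 := hle ha N le_rfl
  rcases le_or_gt (a 0) (a 1) with h01 | h01
  · by_cases hz : a 0 = 0
    · by_cases hb : n = b ∧ a = 0
      · obtain ⟨rfl, rfl⟩ := hb
        refine ⟨1, fun k _ _ M _ _ _ hM => ?_⟩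
        rw [eval_one, Nat.cast_eq_one, hallCount, Nat.card_eq_one_iff_exists]
        refine ⟨⟨⊥, tp_bot, (tp_congr (Submodule.quotEquivOfEqBot ⊥ rfl)).trans hM⟩, ?_⟩
        rintro ⟨L, hL, -⟩
        refine Subtype.ext (eq_bot_of_dm_eq_zero (k := k) ?_)
        rw [← tp_zero, hL, Pi.zero_apply]
      · refine hzero fun k _ _ M _ _ _ hM L hL hL' => hb ?_
        have h0 : L = ⊥ := eq_bot_of_dm_eq_zero (k := k) (by rw [← tp_zero, hL, hz])
        subst h0
        rw [← hM, ← hL, ← hL', tp_bot]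
        exact ⟨(tp_congr (Submodule.quotEquivOfEqBot ⊥ rfl)).symm, rfl⟩
    · refine hzero fun k _ _ M _ _ _ hM L hL _ => hz ?_
      subst hL
      have h1 := dm_kx (k := k) (M := L)
      rw [← tp_const_of_eq (by omega) N, haN]
  obtain ⟨r, hr⟩ := Nat.exists_eq_add_of_lt h01
  replace hr : a 0 = (r + 1) + a 1 := by omega
  have hfin := finite_Iic_type hN
  have hP (κ : ℕ → ℕ) : ∃ P : ℤ[X], κ ≤ n → n 0 = r + 1 + κ 0 → ∀ (k : Type) [Field k] [Finite k]
      (M : Type) [AddCommGroup M] [Module k[X] M] [Finite M], tp k M = κ →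
        (hallCount k M (fun i => a (i + 1)) b : ℤ) = P.eval (Nat.card k : ℤ) := by
    by_cases h : κ ≤ n ∧ n 0 = r + 1 + κ 0
    · obtain ⟨P, hP⟩ := ih (κ 0) (by omega) κ (fun i => a (i + 1)) b (hle h.1) rfl
      exact ⟨P, fun _ _ => hP⟩
    · exact ⟨0, fun h1 h2 => absurd ⟨h1, h2⟩ h⟩
  have hR (c : ℕ → ℕ) : ∃ P : ℤ[X], c 1 < a 1 → ∀ (k : Type) [Field k] [Finite k]
      (M : Type) [AddCommGroup M] [Module k[X] M] [Finite M], tp k M = n →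
        (hallCount k M c b : ℤ) = P.eval (Nat.card k : ℤ) := by
    by_cases h : c 1 < a 1
    · obtain ⟨P, hP⟩ := ih' (c 1) h c rfl
      exact ⟨P, fun _ => hP⟩
    · exact ⟨0, fun h1 => absurd h1 h⟩
  have hS (c : ℕ → ℕ) : ∃ P : ℤ[X], c ≤ n → ∀ (k : Type) [Field k] [Finite k]
      (M : Type) [AddCommGroup M] [Module k[X] M] [Finite M], tp k M = c →
        (Nat.card {E : Submodule k[X] M // E ≤ kx k M ∧ tp k (M ⧸ E) = fun i => a (i + 1)} : ℤ)
          = P.eval (Nat.card k : ℤ) := by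
    by_cases h : c ≤ n
    · obtain ⟨P, hP⟩ := exists_socle_polynomial c (fun i => a (i + 1)) (hle h N le_rfl)
      exact ⟨P, fun _ => hP⟩
    · exact ⟨0, fun h1 => absurd h1 h⟩
  choose P hP using hP
  choose Q hQ using fun κ => exists_socle_polynomial n κ (hN N le_rfl)
  choose R hR using hR
  choose S hS using hS
  refine ⟨∑ κ ∈ hfin.toFinset with n 0 = r + 1 + κ 0, Q κ * P κ
    - ∑ c ∈ hfin.toFinset with c 0 = a 0 ∧ c 1 < a 1, R c * S c, fun k _ _ M _ _ _ hM => ?_⟩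
  subst hM
  simp only [eval_sub, eval_finsetSum, eval_mul]
  refine hallCount_eq_sum_sub_sum (P := fun κ => (P κ).eval (Nat.card k : ℤ))
    (Q := fun κ => (Q κ).eval (Nat.card k : ℤ)) (R := fun κ => (R κ).eval (Nat.card k : ℤ))
    (S := fun κ => (S κ).eval (Nat.card k : ℤ)) hr hab ha (fun κ => by simp)
    (fun E hE => hP _ (tp_quotient_le E) hE k _ rfl) (fun κ => hQ κ k M rfl)
    (fun c hc => hR c hc k M rfl) (fun L => hS _ (tp_submodule_le L) k L rfl)

theorem hallPart_eq_hallCount {k : Type} [Field k] [Finite k] (ν : ℕ →₀ ℕ) {μ lam : ℕ →₀ ℕ}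
    (hμ : μ 0 = 0) (hlam : lam 0 = 0) :
    hallPart k ν μ lam = hallCount k (Imod k ν) (fun i => lam.sum fun j c => c * (j - i))
      (fun i => μ.sum fun j c => c * (j - i)) := by
  refine Nat.card_congr (Equiv.subtypeEquivRight fun L => ?_)
  rw [nonempty_equiv_imod_iff hlam, nonempty_equiv_imod_iff hμ, _root_.funext (tp_imod lam),
    _root_.funext (tp_imod μ)]

theorem eq_of_eval_natCard_eq {P Q : ℤ[X]} (h : ∀ (k : Type) [Field k] [Finite k],
    P.eval (Nat.card k : ℤ) = Q.eval (Nat.card k : ℤ)) : P = Q := by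
  refine eq_of_infinite_eval_eq P Q (((infinite_of_finite_fields
    (p := fun q => P.eval (q : ℤ) = Q.eval (q : ℤ)) h).image
      (f := fun q : ℕ => (q : ℤ)) Nat.cast_injective.injOn).mono ?_)
  rintro _ ⟨q, hq, rfl⟩
  exact hq

end HallPoly

/-- **Existence and uniqueness of Hall polynomials.**  For partitions `λ, μ, ν` (in
multiplicity notation) with `|λ| + |μ| = |ν|`, there is a unique polynomial `P ∈ ℤ[t]`
such that for every finite field `k`, the number of `k[X]`-submodules `L ⊆ I_ν` with
`L ≅ I_λ` and `I_ν/L ≅ I_μ` equals `P(|k|)`. -/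
theorem exists_unique_hall_polynomial
    (ν μ lam : ℕ →₀ ℕ) (hν : ν 0 = 0) (hμ : μ 0 = 0) (hlam : lam 0 = 0)
    (hsize : (lam.sum fun i c => i * c) + (μ.sum fun i c => i * c)
      = ν.sum fun i c => i * c) :
    ∃! P : Polynomial ℤ,
      ∀ (k : Type) [Field k] [Fintype k],
        (hallPart k ν μ lam : ℤ) = P.eval (Fintype.card k : ℤ) := by
  obtain ⟨P, hP⟩ := HallPoly.exists_hall_polynomial (N := ν.support.sup id)
    (fun i => ν.sum fun j c => c * (j - i)) (fun i => lam.sum fun j c => c * (j - i))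
    (fun i => μ.sum fun j c => c * (j - i)) fun i hi => Finset.sum_eq_zero fun j hj => by
      have h : j ≤ i := (Finset.le_sup (f := id) hj).trans hi
      dsimp only
      rw [Nat.sub_eq_zero_of_le h, mul_zero]
  refine ⟨P, fun k _ _ => ?_, fun Q hQ => HallPoly.eq_of_eval_natCard_eq fun k _ _ => ?_⟩
  · rw [HallPoly.hallPart_eq_hallCount ν hμ hlam, ← Nat.card_eq_fintype_card]
    exact hP k _ (funext (HallPoly.tp_imod ν))
  · have := Fintype.ofFinite k
    rw [Nat.card_eq_fintype_card, ← hQ k, HallPoly.hallPart_eq_hallCount ν hμ hlam,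
      ← Nat.card_eq_fintype_card]
    exact hP k _ (funext (HallPoly.tp_imod ν))
end

section
/- Let k be a finite field with q elements and let λ be a partition with parts λ_1 ≥ λ_2 ≥ ⋯, written in multiplicity notation as λ = (1^{l_1}, 2^{l_2}, …, m^{l_m}), where l_i is the number of parts of λ equal to i. Then the number of k[X]-module automorphisms of I_λ(k) = ⊕_{i=1}^{m} (k[X]/(X^i))^{⊕ l_i} equals q^{|λ| + 2n(λ)} · ∏_{i=1}^{m} ∏_{j=1}^{l_i} (1 − q^{−j}), where |λ| = Σ_i i·l_i and n(λ) := Σ_{s ≥ 1} (s−1)·λ_s. -/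
/-- The nilpotent `k[X]`-module `I_λ = ⊕_s k[X]/(X^{p s})` attached to a partition given
by its (weakly decreasing, eventually zero) sequence of parts `p 0 ≥ p 1 ≥ ⋯`
(so `p (s-1)` is the part `λ_s`). -/
noncomputable def ImodParts (k : Type) [Field k] (p : ℕ → ℕ) : Type :=
  DirectSum ℕ (fun s => Polynomial k ⧸ Ideal.span {(Polynomial.X : Polynomial k) ^ p s})

noncomputable instance (k : Type) [Field k] (p : ℕ → ℕ) : AddCommGroup (ImodParts k p) :=
  inferInstanceAs (AddCommGroup (DirectSum ℕ
    (fun s => Polynomial k ⧸ Ideal.span {(Polynomial.X : Polynomial k) ^ p s})))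

noncomputable instance (k : Type) [Field k] (p : ℕ → ℕ) :
    Module (Polynomial k) (ImodParts k p) :=
  inferInstanceAs (Module (Polynomial k) (DirectSum ℕ
    (fun s => Polynomial k ⧸ Ideal.span {(Polynomial.X : Polynomial k) ^ p s})))

open Polynomial in
/-- Tuples `v` in `M` with `X ^ p s • v s = 0` whose translates `X ^ (p s - 1) • v s` are linearly
independent over `k`. -/
def socleIndependentTuples (k : Type) [Field k] (M : Type) [AddCommGroup M] [Module k M]
    [Module k[X] M] (p : ℕ → ℕ) (n : ℕ) : Set (Fin n → M) :=
  {v | (∀ s : Fin n, (X : k[X]) ^ p s • v s = 0) ∧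
    LinearIndependent k (fun s : Fin n => (X : k[X]) ^ (p s - 1) • v s)}

section Counting

open Polynomial Submodule

variable {k : Type} [Field k] {M : Type} [AddCommGroup M] [Module k M] [Module k[X] M]
  [IsScalarTower k k[X] M]

/-- Multiplication by `X ^ (a - 1)` maps `ker X ^ a` onto any subspace contained in its image. -/
theorem card_torsionBy_add_one_eq (W : Submodule k M) [Finite M] (a : ℕ)
    (hW : ∀ w ∈ W, ∃ v : M, (X : k[X]) ^ (a + 1) • v = 0 ∧ (X : k[X]) ^ a • v = w) :
    Nat.card (torsionBy k[X] M (X ^ (a + 1))) =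
      Nat.card {v : M // (X : k[X]) ^ (a + 1) • v = 0 ∧ (X : k[X]) ^ a • v ∉ W} +
        Nat.card (torsionBy k[X] M (X ^ a)) * Nat.card W := by
  classical
  let f : M →ₗ[k] M := (LinearMap.lsmul k[X] M (X ^ a)).restrictScalars k
  let P : Submodule k M := (torsionBy k[X] M (X ^ (a + 1))).restrictScalars k ⊓ W.comap f
  have hPmem (v : M) : v ∈ P ↔ (X : k[X]) ^ (a + 1) • v = 0 ∧ (X : k[X]) ^ a • v ∈ W := Iff.rfl
  let g : P →ₗ[k] W := (f.comp P.subtype).codRestrict W (fun v => ((hPmem v).1 v.2).2)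
  have hg : Function.Surjective g := by
    rintro ⟨w, hw⟩
    obtain ⟨v, hv, hvw⟩ := hW w hw
    exact ⟨⟨v, (hPmem v).2 ⟨hv, hvw ▸ hw⟩⟩, Subtype.ext hvw⟩
  have hker : Nat.card (LinearMap.ker g) = Nat.card (torsionBy k[X] M (X ^ a)) := by
    refine Nat.card_congr ⟨fun v => ⟨v.1.1, ?_⟩, fun v => ⟨⟨v.1, ?_⟩, ?_⟩, fun _ => rfl,
      fun _ => rfl⟩
    · exact congrArg Subtype.val (LinearMap.mem_ker.1 v.2)
    · have hv : (X : k[X]) ^ a • v.1 = 0 := v.2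
      rw [hPmem, pow_succ', mul_smul, hv, smul_zero]
      exact ⟨rfl, W.zero_mem⟩
    · exact Subtype.ext v.2
  have hP : Nat.card P = Nat.card (torsionBy k[X] M (X ^ a)) * Nat.card W := by
    rw [card_eq_card_quotient_mul_card (LinearMap.ker g), hker,
      Nat.card_congr (g.quotKerEquivOfSurjective hg).toEquiv]
  rw [← hP, Nat.add_comm (Nat.card _), ← Nat.card_sum]
  refine Nat.card_congr ((Equiv.Set.sumDiffSubset (s := (P : Set M))
    (t := (torsionBy k[X] M (X ^ (a + 1)) : Set M)) fun v hv => hv.1).symm.trans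
    (Equiv.sumCongr (Equiv.refl _) (Equiv.subtypeEquivRight fun v => ?_)))
  change (_ ∧ ¬ (_ ∧ _)) ↔ _
  constructor
  · exact fun h => ⟨h.1, fun h' => h.2 ⟨h.1, h'⟩⟩
  · exact fun h => ⟨h.1, fun h' => h.2 h'.2⟩

theorem card_socleIndependentTuples_succ [Fintype k] [Finite M] {p : ℕ → ℕ} (hp : Antitone p)
    {n a : ℕ} (ha : p n = a + 1) :
    (Nat.card (socleIndependentTuples k M p (n + 1)) : ℚ) =
      Nat.card (socleIndependentTuples k M p n) *
        (Nat.card (torsionBy k[X] M (X ^ (a + 1))) -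
          Nat.card (torsionBy k[X] M (X ^ a)) * (Fintype.card k : ℚ) ^ n) := by
  let u (v : Fin n → M) (s : Fin n) : M := (X : k[X]) ^ (p s - 1) • v s
  let F (v : Fin n → M) := {w : M // (X : k[X]) ^ (a + 1) • w = 0 ∧
      (X : k[X]) ^ a • w ∉ span k (Set.range (u v))}
  have hF (v : socleIndependentTuples k M p n) : (Nat.card (F v) : ℚ) =
      Nat.card (torsionBy k[X] M (X ^ (a + 1))) -
          Nat.card (torsionBy k[X] M (X ^ a)) * (Fintype.card k : ℚ) ^ n := by
    have hW : Nat.card (span k (Set.range (u v))) = Fintype.card k ^ n := by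
      rw [Module.natCard_eq_pow_finrank (K := k), finrank_span_eq_card v.2.2,
        Nat.card_eq_fintype_card, Fintype.card_fin]
    have := card_torsionBy_add_one_eq (k := k) (span k (Set.range (u v))) a ?_
    · rw [hW] at this
      rw [this]
      push_cast
      ring
    · let f : M →ₗ[k] M := (LinearMap.lsmul k[X] M (X ^ a)).restrictScalars k
      have hle : span k (Set.range (u v)) ≤
          ((torsionBy k[X] M (X ^ (a + 1))).restrictScalars k).map f := by
        rw [span_le]
        rintro _ ⟨s, rfl⟩
        have hs : a + 1 ≤ p s := ha ▸ hp s.2.le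
        refine ⟨(X : k[X]) ^ (p s - (a + 1)) • v.1 s, ?_, ?_⟩
        · change (X : k[X]) ^ (a + 1) • (X : k[X]) ^ (p s - (a + 1)) • v.1 s = 0
          rw [smul_smul, ← pow_add, Nat.add_sub_cancel' hs, v.2.1 s]
        · change (X : k[X]) ^ a • (X : k[X]) ^ (p s - (a + 1)) • v.1 s = _
          rw [smul_smul, ← pow_add]
          congr 2
          omega
      intro w hw
      obtain ⟨x, hx, rfl⟩ := hle hw
      exact ⟨x, hx, rfl⟩
  have e : socleIndependentTuples k M p (n + 1) ≃ Σ v : socleIndependentTuples k M p n, F v := by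
    have key (v : Fin n → M) (w : M) :
        (Fin.snoc v w : Fin (n + 1) → M) ∈ socleIndependentTuples k M p (n + 1) ↔
          v ∈ socleIndependentTuples k M p n ∧ (X : k[X]) ^ (a + 1) • w = 0 ∧
      (X : k[X]) ^ a • w ∉ span k (Set.range (u v)) := by
      have hsn : (fun s : Fin (n + 1) => (X : k[X]) ^ (p s - 1) •
          (Fin.snoc v w : Fin (n + 1) → M) s) = Fin.snoc (u v) ((X : k[X]) ^ a • w) := by
        funext s
        refine Fin.lastCases ?_ (fun i => ?_) s
        · simp [ha]
        · simp [u]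
      change (_ ∧ _) ↔ (_ ∧ _) ∧ _
      rw [hsn, linearIndependent_finSnoc, Fin.forall_fin_succ']
      simp only [Fin.snoc_castSucc, Fin.snoc_last, Fin.val_castSucc, Fin.val_last, ha]
      tauto
    refine ⟨fun v => ⟨⟨Fin.init v.1, ?_⟩, ⟨v.1 (Fin.last n), ?_⟩⟩,
      fun x => ⟨Fin.snoc x.1.1 x.2.1, (key _ _).2 ⟨x.1.2, x.2.2⟩⟩, ?_, ?_⟩
    · exact ((key _ _).1 ((Fin.snoc_init_self v.1).symm ▸ v.2)).1
    · exact ((key _ _).1 ((Fin.snoc_init_self v.1).symm ▸ v.2)).2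
    · intro v
      exact Subtype.ext (Fin.snoc_init_self v.1)
    · rintro ⟨⟨v, hv⟩, ⟨w, hw⟩⟩
      have h1 : Fin.init (Fin.snoc v w : Fin (n + 1) → M) = v := Fin.init_snoc ..
      have h2 : (Fin.snoc v w : Fin (n + 1) → M) (Fin.last n) = w := Fin.snoc_last ..
      refine Sigma.ext (Subtype.ext h1) ?_
      dsimp only
      congr 1
      · rw [h1]
      · simp [h1, h2]
  have : Fintype (socleIndependentTuples k M p n) := Fintype.ofFinite _
  have (v : socleIndependentTuples k M p n) : Finite (F v) := Subtype.finite
  rw [Nat.card_congr e, Nat.card_sigma, Nat.cast_sum, Finset.sum_congr rfl fun v _ => hF v,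
    Finset.sum_const, nsmul_eq_mul, Finset.card_univ,
    ← Nat.card_eq_fintype_card (α := socleIndependentTuples k M p n)]

end Counting

section TruncatedPolynomials

open Polynomial Submodule

variable {k : Type} [Field k]

instance finite_quotient_span_X_pow [Finite k] (b : ℕ) :
    Finite (k[X] ⧸ Ideal.span {(X : k[X]) ^ b}) :=
  have := (monic_X_pow (R := k) b).finite_quotient
  Module.finite_of_finite k

theorem quotient_mk_smul_eq_zero_iff {b : ℕ} {g f : k[X]} :
    g • (Ideal.Quotient.mk (Ideal.span {(X : k[X]) ^ b}) f) = 0 ↔ X ^ b ∣ g * f := by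
  rw [← Ideal.mem_span_singleton, ← Ideal.Quotient.eq_zero_iff_mem, map_mul]
  rfl

theorem smul_one_eq_quotient_mk {I : Ideal k[X]} (f : k[X]) :
    f • (1 : k[X] ⧸ I) = Ideal.Quotient.mk I f :=
  congrArg (Ideal.Quotient.mk I) (mul_one f)

theorem card_torsionBy_quotient_span_X_pow [Finite k] (a b : ℕ) :
    Nat.card (torsionBy k[X] (k[X] ⧸ Ideal.span {(X : k[X]) ^ b}) (X ^ a)) =
      Nat.card k ^ min b a := by
  let g : k[X] →ₗ[k[X]] (k[X] ⧸ Ideal.span {(X : k[X]) ^ b}) :=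
    (Ideal.span {(X : k[X]) ^ b}).mkQ ∘ₗ LinearMap.lsmul k[X] k[X] (X ^ (b - a))
  have hg (f : k[X]) : g f = Ideal.Quotient.mk _ (X ^ (b - a) * f) := rfl
  have hker : LinearMap.ker g = Ideal.span {(X : k[X]) ^ min b a} := by
    ext f
    rw [LinearMap.mem_ker, hg, Ideal.Quotient.eq_zero_iff_mem, Ideal.mem_span_singleton,
      Ideal.mem_span_singleton]
    nth_rw 1 [show b = (b - a) + min b a by omega]
    rw [pow_add, mul_dvd_mul_iff_left (pow_ne_zero _ X_ne_zero)]
  have hrange : LinearMap.range g = torsionBy k[X] _ (X ^ a) := by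
    ext x
    obtain ⟨f, rfl⟩ := Ideal.Quotient.mk_surjective x
    rw [mem_torsionBy_iff, quotient_mk_smul_eq_zero_iff]
    have h : (X : k[X]) ^ b ∣ X ^ a * f ↔ X ^ (b - a) ∣ f := by
      rcases le_total a b with hab | hab
      · nth_rw 1 [show b = a + (b - a) by omega]
        rw [pow_add, mul_dvd_mul_iff_left (pow_ne_zero _ X_ne_zero)]
      · rw [Nat.sub_eq_zero_of_le hab, pow_zero]
        exact iff_of_true ((pow_dvd_pow _ hab).mul_right _) (one_dvd _)
    rw [h]
    constructor
    · rintro ⟨y, hy⟩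
      rw [hg, Ideal.Quotient.eq, Ideal.mem_span_singleton] at hy
      have h1 : (X : k[X]) ^ (b - a) ∣ X ^ (b - a) * y - f :=
        (pow_dvd_pow _ (Nat.sub_le _ _)).trans hy
      exact (dvd_sub_right (dvd_mul_right _ _)).1 h1
    · rintro ⟨y, rfl⟩
      exact ⟨y, rfl⟩
  rw [← hrange, ← Nat.card_congr g.quotKerEquivRange.toEquiv, hker]
  have := (monic_X_pow (R := k) (min b a)).finite_quotient
  rw [Module.natCard_eq_pow_finrank (K := k), finrank_quotient_span_eq_natDegree, natDegree_X_pow]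

theorem card_torsionBy_pi {R : Type} [CommRing R] {ι : Type} [Fintype ι] (Q : ι → Type)
    [∀ i, AddCommGroup (Q i)] [∀ i, Module R (Q i)] (r : R) :
    Nat.card (torsionBy R (∀ i, Q i) r) = ∏ i, Nat.card (torsionBy R (Q i) r) := by
  rw [← Nat.card_pi]
  exact Nat.card_congr ⟨fun x i => ⟨x.1 i, congrFun x.2 i⟩,
    fun x => ⟨fun i => (x i).1, funext fun i => (x i).2⟩, fun _ => rfl, fun _ => rfl⟩

theorem exists_smul_X_pow_eq_of_X_smul_eq_zero {b : ℕ}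
    {x : k[X] ⧸ Ideal.span {(X : k[X]) ^ (b + 1)}} (hx : (X : k[X]) • x = 0) :
    ∃ c : k, x = c • Ideal.Quotient.mk _ (X ^ b) := by
  obtain ⟨f, rfl⟩ := Ideal.Quotient.mk_surjective x
  rw [quotient_mk_smul_eq_zero_iff, pow_succ', mul_dvd_mul_iff_left X_ne_zero] at hx
  obtain ⟨g, rfl⟩ := hx
  refine ⟨g.coeff 0, ?_⟩
  have h : g.coeff 0 • Ideal.Quotient.mk (Ideal.span {(X : k[X]) ^ (b + 1)}) (X ^ b) =
      Ideal.Quotient.mk _ (C (g.coeff 0) * X ^ b) := by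
    rw [← smul_eq_C_mul]
    rfl
  rw [h, Ideal.Quotient.eq, Ideal.mem_span_singleton, mul_comm, ← sub_mul, pow_succ']
  refine mul_dvd_mul_right (X_dvd_iff.2 (by simp)) _

theorem eq_zero_of_smul_X_pow_eq_zero {b : ℕ} {c : k}
    (hc : c • Ideal.Quotient.mk (Ideal.span {(X : k[X]) ^ (b + 1)}) (X ^ b) = 0) : c = 0 := by
  have h : c • Ideal.Quotient.mk (Ideal.span {(X : k[X]) ^ (b + 1)}) (X ^ b) =
      Ideal.Quotient.mk _ (C c * X ^ b) := by
    rw [← smul_eq_C_mul]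
    rfl
  rw [h, Ideal.Quotient.eq_zero_iff_mem, Ideal.mem_span_singleton, X_pow_dvd_iff] at hc
  simpa using hc b (Nat.lt_succ_self b)

variable {n : ℕ} {p : ℕ → ℕ}

theorem injective_iff_linearIndependent_socle (hp : ∀ s, s < n → 0 < p s)
    {M : Type} [AddCommGroup M] [Module k M] [Module k[X] M] [IsScalarTower k k[X] M]
    (φ : (∀ s : Fin n, k[X] ⧸ Ideal.span {(X : k[X]) ^ p s}) →ₗ[k[X]] M) :
    Function.Injective φ ↔ LinearIndependent k
      (fun s : Fin n => (X : k[X]) ^ (p s - 1) • φ (Pi.single s 1)) := by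
  let b (s : Fin n) : ∀ s : Fin n, k[X] ⧸ Ideal.span {(X : k[X]) ^ p s} :=
    Pi.single s (Ideal.Quotient.mk _ (X ^ (p s - 1)))
  have hb (s : Fin n) : (X : k[X]) ^ (p s - 1) • φ (Pi.single s 1) = φ (b s) := by
    rw [← map_smul, ← Pi.single_smul]
    rw [smul_one_eq_quotient_mk]
  have hsum (c : Fin n → k) (t : Fin n) :
      (∑ s, c s • b s) t = c t • Ideal.Quotient.mk _ (X ^ (p t - 1)) := by
    rw [Finset.sum_apply, Finset.sum_eq_single t]
    · simp only [Pi.smul_apply, b, Pi.single_eq_same]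
    · intro s _ hs
      simp only [Pi.smul_apply, b, Pi.single_eq_of_ne hs.symm, smul_zero]
    · exact fun h => absurd (Finset.mem_univ t) h
  have hφ (c : Fin n → k) : φ (∑ s, c s • b s) = ∑ s, c s • φ (b s) := by
    rw [map_sum]
    exact Finset.sum_congr rfl fun s _ => (φ.restrictScalars k).map_smul _ _
  simp_rw [hb]
  rw [Fintype.linearIndependent_iff]
  constructor
  · intro h c hc t
    rw [← hφ] at hc
    have ht := congrFun ((map_eq_zero_iff φ h).1 hc) t
    rw [hsum, Pi.zero_apply] at ht
    have hpt := hp t t.2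
    revert ht
    generalize p t = a at hpt ⊢
    obtain ⟨a, rfl⟩ := Nat.exists_eq_succ_of_ne_zero hpt.ne'
    exact eq_zero_of_smul_X_pow_eq_zero
  · intro h
    have socle (x : ∀ s : Fin n, k[X] ⧸ Ideal.span {(X : k[X]) ^ p s})
        (hX : (X : k[X]) • x = 0) (hx : φ x = 0) : x = 0 := by
      have hc (t : Fin n) : ∃ c : k, x t = c • Ideal.Quotient.mk _ (X ^ (p t - 1)) := by
        have hpt := hp t t.2
        have hxt : (X : k[X]) • x t = 0 := congrFun hX t
        revert hxt
        generalize x t = y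
        revert y
        generalize p t = a at hpt ⊢
        obtain ⟨a, rfl⟩ := Nat.exists_eq_succ_of_ne_zero hpt.ne'
        exact fun y hy => exists_smul_X_pow_eq_of_X_smul_eq_zero hy
      choose c hc using hc
      have hxc : x = ∑ s, c s • b s := funext fun t => by rw [hsum, hc]
      rw [hxc, hφ] at hx
      rw [hxc]
      exact Finset.sum_eq_zero fun s _ => by rw [h c hx s]; exact zero_smul k (b s)
    have key (m : ℕ) : ∀ x : ∀ s : Fin n, k[X] ⧸ Ideal.span {(X : k[X]) ^ p s},
        (X : k[X]) ^ m • x = 0 → φ x = 0 → x = 0 := by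
      induction m with
      | zero => intro x hx _; simpa using hx
      | succ m ih =>
        intro x hx hφx
        refine ih x (socle _ ?_ ?_) hφx
        · rw [smul_smul, ← pow_succ', hx]
        · rw [map_smul, hφx, smul_zero]
    refine (injective_iff_map_eq_zero φ).2 fun x hx => key (∑ s : Fin n, p s) x ?_ hx
    funext s
    change (X : k[X]) ^ (∑ s : Fin n, p s) • x s = 0
    obtain ⟨f, hf⟩ := Ideal.Quotient.mk_surjective (x s)
    rw [← hf, quotient_mk_smul_eq_zero_iff]
    exact (pow_dvd_pow _ (Finset.single_le_sum (f := fun s : Fin n => p s)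
      (fun _ _ => Nat.zero_le _) (Finset.mem_univ s))).mul_right _

theorem card_linearEquiv_pi_eq_card_socleIndependentTuples [Finite k]
    (hp : ∀ s, s < n → 0 < p s) :
    Nat.card ((∀ s : Fin n, k[X] ⧸ Ideal.span {(X : k[X]) ^ p s}) ≃ₗ[k[X]]
        (∀ s : Fin n, k[X] ⧸ Ideal.span {(X : k[X]) ^ p s})) =
      Nat.card (socleIndependentTuples k
        (∀ s : Fin n, k[X] ⧸ Ideal.span {(X : k[X]) ^ p s}) p n) := by
  let Q (s : Fin n) := k[X] ⧸ Ideal.span {(X : k[X]) ^ p s}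
  have htor (s : Fin n) : (X : k[X]) ^ p s • (Pi.single s 1 : ∀ s, Q s) = 0 := by
    rw [← Pi.single_smul]
    have : (X : k[X]) ^ p s • (1 : Q s) = 0 := by
      rw [← map_one (Ideal.Quotient.mk _), quotient_mk_smul_eq_zero_iff, mul_one]
    rw [this, Pi.single_zero]
  refine Nat.card_congr (Equiv.ofBijective (fun e => ⟨fun s => e (Pi.single s 1), ?_, ?_⟩) ⟨?_, ?_⟩)
  · intro s
    rw [← map_smul, htor, map_zero]
  · exact (injective_iff_linearIndependent_socle hp e.toLinearMap).1 e.injective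
  · intro e e' h
    refine LinearEquiv.toLinearMap_injective (LinearMap.pi_ext' fun s => LinearMap.ext fun x => ?_)
    obtain ⟨f, rfl⟩ := Ideal.Quotient.mk_surjective x
    have h1 : (Pi.single s (Ideal.Quotient.mk _ f) : ∀ s, Q s) = f • Pi.single s 1 := by
      rw [← Pi.single_smul, smul_one_eq_quotient_mk]
    have h2 : e (Pi.single s 1) = e' (Pi.single s 1) := congrFun (congrArg Subtype.val h) s
    change e (Pi.single s _) = e' (Pi.single s _)
    rw [h1, map_smul, map_smul, h2]
  · rintro ⟨v, hv, hvind⟩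
    let φ : (∀ s, Q s) →ₗ[k[X]] (∀ s, Q s) := LinearMap.lsum k[X] Q k[X] fun s =>
      liftQSpanSingleton ((X : k[X]) ^ p s) (LinearMap.toSpanSingleton k[X] _ (v s)) (hv s)
    have hφ (s : Fin n) : φ (Pi.single s 1) = v s := by
      rw [LinearMap.lsum_piSingle]
      exact (liftQSpanSingleton_apply ..).trans (one_smul _ _)
    have hinj : Function.Injective φ := by
      rw [injective_iff_linearIndependent_socle hp]
      simpa only [hφ] using hvind
    refine ⟨LinearEquiv.ofBijective φ ⟨hinj, Finite.injective_iff_surjective.1 hinj⟩, ?_⟩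
    exact Subtype.ext (funext hφ)

end TruncatedPolynomials

section PartitionSums

open Finset

theorem sum_sum_min_of_antitone {p : ℕ → ℕ} (hp : Antitone p) (n : ℕ) :
    ∑ s ∈ range n, ∑ j ∈ range n, min (p j) (p s) =
      ∑ s ∈ range n, p s + 2 * ∑ s ∈ range n, s * p s := by
  induction n with
  | zero => simp
  | succ n ih =>
    have h1 : ∑ j ∈ range n, min (p j) (p n) = n * p n := by
      rw [sum_congr rfl fun j hj => min_eq_right (hp (mem_range.1 hj).le), sum_const, card_range,
        smul_eq_mul]
    have h2 : ∑ s ∈ range n, min (p n) (p s) = n * p n := by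
      rw [← h1]
      exact sum_congr rfl fun j _ => min_comm _ _
    simp only [sum_range_succ, sum_add_distrib, ih, h1, h2, min_self]
    ring

/-- Conjugate partition of an antitone, eventually zero sequence. -/
theorem exists_conjugate_of_antitone {p : ℕ → ℕ} (hp : Antitone p)
    (hp0 : ∃ S, ∀ s, S ≤ s → p s = 0) (i : ℕ) :
    ∃ d, 0 < i → ∀ s, i ≤ p s ↔ s < d := by
  rcases Nat.eq_zero_or_pos i with rfl | hi
  · exact ⟨0, fun h => absurd h (lt_irrefl 0)⟩
  · have hex : ∃ s, p s < i := by
      obtain ⟨S, hS⟩ := hp0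
      exact ⟨S, by rwa [hS S le_rfl]⟩
    refine ⟨Nat.find hex, fun _ s => ?_⟩
    constructor
    · intro h
      by_contra! hs
      exact absurd ((hp hs).trans_lt (Nat.find_spec hex)) (not_lt.2 h)
    · intro h
      exact not_lt.1 (Nat.find_min hex h)

theorem sum_min_succ {p d : ℕ → ℕ} (hd : ∀ i, 0 < i → ∀ s, i ≤ p s ↔ s < d i) (a : ℕ) :
    ∑ j ∈ range (d 1), min (p j) (a + 1) = ∑ j ∈ range (d 1), min (p j) a + d (a + 1) := by
  have h (j : ℕ) : min (p j) (a + 1) = min (p j) a + if j < d (a + 1) then 1 else 0 := by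
    simp only [← hd (a + 1) a.succ_pos j]
    split_ifs <;> omega
  have hf : (range (d 1)).filter (· < d (a + 1)) = range (d (a + 1)) := by
    ext j
    have h1 := hd 1 one_pos j
    have h2 := hd (a + 1) a.succ_pos j
    simp only [mem_filter, mem_range]
    omega
  rw [sum_congr rfl fun j _ => h j, sum_add_distrib, ← card_filter, hf, card_range]

theorem prod_range_conjugate_eq_prod_prod {R : Type} [CommMonoid R] {p d : ℕ → ℕ} (hp : Antitone p)
    (hd : ∀ i, 0 < i → ∀ s, i ≤ p s ↔ s < d i) (f : ℕ → R) :
    ∏ s ∈ range (d 1), f (d (p s) - s) =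
      ∏ i ∈ Icc 1 (p 0), ∏ j ∈ Icc 1 (Nat.card {s : ℕ // p s = i}), f j := by
  rw [← prod_fiberwise_of_maps_to (g := p) (t := Icc 1 (p 0))]
  · refine prod_congr rfl fun i hi => ?_
    have hi := (mem_Icc.1 hi).1
    have hfib (s : ℕ) : p s = i ↔ d (i + 1) ≤ s ∧ s < d i := by
      have h1 := hd i hi s
      have h2 := hd (i + 1) i.succ_pos s
      omega
    have hcard : Nat.card {s : ℕ // p s = i} = d i - d (i + 1) := by
      rw [Nat.subtype_card (Ico (d (i + 1)) (d i)) fun s => by rw [mem_Ico, hfib], Nat.card_Ico]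
    rw [hcard]
    refine prod_bij' (fun s _ => d i - s) (fun j _ => d i - j) ?_ ?_ ?_ ?_ ?_
    · intro s hs
      have := (hfib s).1 (mem_filter.1 hs).2
      rw [mem_Icc]
      omega
    · intro j hj
      have hj := mem_Icc.1 hj
      have h1 := (hfib (d i - j)).2 (by omega)
      rw [mem_filter, mem_range, ← hd 1 one_pos]
      omega
    · intro s hs
      have := (hfib s).1 (mem_filter.1 hs).2
      omega
    · intro j hj
      have hj := mem_Icc.1 hj
      omega
    · intro s hs
      rw [(mem_filter.1 hs).2]
  · intro s hs
    exact mem_Icc.2 ⟨(hd 1 one_pos s).2 (mem_range.1 hs), hp s.zero_le⟩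

end PartitionSums

section Automorphisms

open Polynomial Submodule

variable {k : Type} [Field k] [Fintype k] {p d : ℕ → ℕ}

theorem card_torsionBy_pi_quotient_span_X_pow (n a : ℕ) :
    Nat.card (torsionBy k[X] (∀ s : Fin n, k[X] ⧸ Ideal.span {(X : k[X]) ^ p s}) (X ^ a)) =
      Fintype.card k ^ ∑ j ∈ Finset.range n, min (p j) a := by
  rw [card_torsionBy_pi, Finset.prod_congr rfl fun (s : Fin n) _ =>
      card_torsionBy_quotient_span_X_pow (k := k) a (p s),
    Finset.prod_pow_eq_pow_sum, Nat.card_eq_fintype_card,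
    Fin.sum_univ_eq_sum_range fun j => min (p j) a]

theorem card_socleIndependentTuples_eq_prod (hp : Antitone p)
    (hd : ∀ i, 0 < i → ∀ s, i ≤ p s ↔ s < d i) {n : ℕ} (hn : n ≤ d 1) :
    (Nat.card (socleIndependentTuples k
        (∀ s : Fin (d 1), k[X] ⧸ Ideal.span {(X : k[X]) ^ p s}) p n) : ℚ) =
      ∏ s ∈ Finset.range n, ((Fintype.card k : ℚ) ^ (∑ j ∈ Finset.range (d 1), min (p j) (p s)) *
        (1 - (Fintype.card k : ℚ)⁻¹ ^ (d (p s) - s))) := by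
  induction n with
  | zero =>
    have h : socleIndependentTuples k
        (∀ s : Fin (d 1), k[X] ⧸ Ideal.span {(X : k[X]) ^ p s}) p 0 = Set.univ :=
      Set.eq_univ_of_forall fun v => ⟨fun s => s.elim0, linearIndependent_empty_type⟩
    rw [h, Finset.range_zero, Finset.prod_empty, Nat.card_univ, Nat.card_unique, Nat.cast_one]
  | succ n ih =>
    have hpos : 0 < p n := (hd 1 one_pos n).2 hn
    obtain ⟨a, ha⟩ := Nat.exists_eq_succ_of_ne_zero hpos.ne'
    have hlt : n < d (a + 1) := (hd (a + 1) a.succ_pos n).1 ha.ge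
    have hq : (Fintype.card k : ℚ) ≠ 0 := Nat.cast_ne_zero.2 Fintype.card_ne_zero
    rw [card_socleIndependentTuples_succ hp ha, ih (Nat.le_of_succ_le hn), Finset.prod_range_succ,
      card_torsionBy_pi_quotient_span_X_pow, card_torsionBy_pi_quotient_span_X_pow, ha,
      Nat.succ_eq_add_one, sum_min_succ hd]
    congr 1
    obtain ⟨c, hc⟩ := Nat.exists_eq_add_of_lt hlt
    rw [hc, show n + c + 1 - n = c + 1 by omega]
    push_cast
    rw [inv_pow]
    field_simp
    ring

theorem card_linearEquiv_pi_quotient_span_X_pow (hp : Antitone p)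
    (hd : ∀ i, 0 < i → ∀ s, i ≤ p s ↔ s < d i) :
    (Nat.card ((∀ s : Fin (d 1), k[X] ⧸ Ideal.span {(X : k[X]) ^ p s}) ≃ₗ[k[X]]
        (∀ s : Fin (d 1), k[X] ⧸ Ideal.span {(X : k[X]) ^ p s})) : ℚ) =
      (Fintype.card k : ℚ) ^
          (∑ s ∈ Finset.range (d 1), p s + 2 * ∑ s ∈ Finset.range (d 1), s * p s) *
        ∏ i ∈ Finset.Icc 1 (p 0), ∏ j ∈ Finset.Icc 1 (Nat.card {s : ℕ // p s = i}),
          (1 - (Fintype.card k : ℚ)⁻¹ ^ j) := by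
  rw [card_linearEquiv_pi_eq_card_socleIndependentTuples fun s hs => (hd 1 one_pos s).2 hs,
    card_socleIndependentTuples_eq_prod hp hd le_rfl, Finset.prod_mul_distrib,
    Finset.prod_pow_eq_pow_sum, sum_sum_min_of_antitone hp,
    prod_range_conjugate_eq_prod_prod hp hd fun j => 1 - (Fintype.card k : ℚ)⁻¹ ^ j]

/-- Dropping the zero summands of a direct sum. -/
theorem nonempty_linearEquiv_directSum_pi_fin {R : Type} [Semiring R] (Q : ℕ → Type)
    [∀ s, AddCommMonoid (Q s)] [∀ s, Module R (Q s)] (n : ℕ)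
    (h : ∀ s, n ≤ s → Subsingleton (Q s)) :
    Nonempty (DirectSum ℕ Q ≃ₗ[R] ∀ s : Fin n, Q s) := by
  refine ⟨LinearEquiv.ofBijective
    (LinearMap.pi fun s : Fin n => DirectSum.component R ℕ Q s) ⟨?_, ?_⟩⟩
  · intro x y hxy
    refine DFinsupp.ext fun s => ?_
    rcases lt_or_ge s n with hs | hs
    · exact congrFun hxy ⟨s, hs⟩
    · have := h s hs
      exact Subsingleton.elim _ _
  · intro y
    let w (s : (Finset.range n : Set ℕ)) : Q s := y ⟨s.1, Finset.mem_range.1 s.2⟩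
    exact ⟨DFinsupp.mk (Finset.range n) w, funext fun s =>
      DFinsupp.mk_of_mem (x := w) (Finset.mem_range.2 s.2)⟩

end Automorphisms

/-- The number of `k[X]`-module automorphisms of `I_λ`, for `k` a finite field with `q`
elements and `λ` the partition with parts `p 0 ≥ p 1 ≥ ⋯` (so `λ_s = p (s-1)`, the largest
part is `m = p 0`, and `l_i = #{s : p s = i}` is the multiplicity of `i`), equals
`q^{|λ| + 2n(λ)} · ∏_{i=1}^{m} ∏_{j=1}^{l_i} (1 - q^{-j})`, where `|λ| = Σ_s p s` and
`n(λ) = Σ_{s≥1} (s-1)·λ_s = Σ_s s·(p s)`. -/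
theorem card_aut_of_nilpotent_module
    (k : Type) [Field k] [Fintype k]
    (p : ℕ → ℕ) (hp : ∀ s, p (s + 1) ≤ p s) (hp0 : ∃ S, ∀ s, S ≤ s → p s = 0) :
    (Nat.card (ImodParts k p ≃ₗ[Polynomial k] ImodParts k p) : ℚ)
      = (Fintype.card k : ℚ) ^ ((∑ᶠ s : ℕ, p s) + 2 * ∑ᶠ s : ℕ, s * p s)
        * ∏ i ∈ Finset.Icc 1 (p 0),
            ∏ j ∈ Finset.Icc 1 (Nat.card {s : ℕ // p s = i}),
              (1 - ((Fintype.card k : ℚ))⁻¹ ^ j) := by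
  have hanti : Antitone p := antitone_nat_of_succ_le hp
  choose d hd using exists_conjugate_of_antitone hanti hp0
  have hzero (s : ℕ) (hs : d 1 ≤ s) : p s = 0 := by
    have := hd 1 one_pos s
    omega
  have hsub (s : ℕ) (hs : d 1 ≤ s) :
      Subsingleton (Polynomial k ⧸ Ideal.span {(Polynomial.X : Polynomial k) ^ p s}) := by
    rw [hzero s hs, pow_zero, Ideal.span_singleton_one]
    exact Ideal.Quotient.subsingleton_iff.2 rfl
  obtain ⟨e⟩ := nonempty_linearEquiv_directSum_pi_fin (R := Polynomial k) _ (d 1) hsub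
  have e' : ImodParts k p ≃ₗ[Polynomial k] ∀ s : Fin (d 1),
      Polynomial k ⧸ Ideal.span {(Polynomial.X : Polynomial k) ^ p s} := e
  let c : (ImodParts k p ≃ₗ[Polynomial k] ImodParts k p) ≃
      ((∀ s : Fin (d 1), Polynomial k ⧸ Ideal.span {(Polynomial.X : Polynomial k) ^ p s})
        ≃ₗ[Polynomial k]
      (∀ s : Fin (d 1), Polynomial k ⧸ Ideal.span {(Polynomial.X : Polynomial k) ^ p s})) :=
    ⟨fun f => e'.symm.trans (f.trans e'), fun f => e'.trans (f.trans e'.symm),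
      fun f => by ext; simp, fun f => by ext1 x; simp⟩
  rw [finsum_eq_sum_of_support_subset (s := Finset.range (d 1)) p,
    finsum_eq_sum_of_support_subset (s := Finset.range (d 1)) fun s => s * p s,
    ← card_linearEquiv_pi_quotient_span_X_pow hanti hd]
  · rw [Nat.card_congr c]
  all_goals
    intro s hs
    rw [Finset.coe_range, Set.mem_Iio]
    by_contra! h
    simp [hzero s h] at hs
end

section
/- Let k be a finite field with q elements. For integers t, w ≥ 0 let a_{t,w} denote the number of ordered pairs (P,Q) of nonzero polynomials in k[X,Y] with P homogeneous of degree t and Q homogeneous of degree w, such that P and Q are relatively prime, i.e. every common divisor of P and Q in k[X,Y] is a unit. Then a_{t,w} = (q−1)(q^{t+w+1} − 1) if t = 0 or w = 0, and a_{t,w} = (q−1)(q²−1)·q^{t+w−1} if t ≥ 1 and w ≥ 1. -/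
namespace MvPolynomial

section Homogenization

variable {σ R : Type*} [CommRing R]

/-- The algebra map `f(X) ↦ f(T X)`, which records homogeneous components as coefficients. -/
noncomputable def scaleVariables :
    MvPolynomial σ R →ₐ[R] Polynomial (MvPolynomial σ R) :=
  aeval fun i => Polynomial.C (X i) * Polynomial.X

theorem scaleVariables_monomial (d : σ →₀ ℕ) (r : R) :
    scaleVariables (monomial d r) = Polynomial.monomial d.degree (monomial d r) := by
  rw [scaleVariables, aeval_monomial, ← Polynomial.C_mul_X_pow_eq_monomial, monomial_eq,
    Finsupp.degree, Finsupp.prod, Finsupp.prod]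
  simp only [mul_pow, Finset.prod_mul_distrib, Finset.prod_pow_eq_pow_sum, map_mul, map_prod,
    map_pow, mul_assoc]
  rfl

theorem coeff_scaleVariables (f : MvPolynomial σ R) (n : ℕ) :
    (scaleVariables f).coeff n = homogeneousComponent n f := by
  induction f using MvPolynomial.induction_on' with
  | monomial d r =>
    rw [scaleVariables_monomial, Polynomial.coeff_monomial,
      homogeneousComponent_of_mem (isHomogeneous_monomial r rfl)]
    simp only [eq_comm]
  | add p q hp hq => rw [map_add, Polynomial.coeff_add, hp, hq, map_add]

theorem isHomogeneous_iff_scaleVariables {f : MvPolynomial σ R} {n : ℕ} :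
    f.IsHomogeneous n ↔ scaleVariables f = Polynomial.monomial n f := by
  constructor
  · intro hf
    ext1 m
    rw [coeff_scaleVariables, Polynomial.coeff_monomial, homogeneousComponent_of_mem hf]
    simp only [eq_comm]
  · intro hf
    have h := coeff_scaleVariables f n
    rw [hf, Polynomial.coeff_monomial_same] at h
    rw [h]
    exact homogeneousComponent_isHomogeneous n f

theorem scaleVariables_ne_zero {f : MvPolynomial σ R} (hf : f ≠ 0) : scaleVariables f ≠ 0 := by
  intro h
  apply hf
  rw [← sum_homogeneousComponent f]
  exact Finset.sum_eq_zero fun i _ => by rw [← coeff_scaleVariables, h, Polynomial.coeff_zero]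

theorem isHomogeneous_of_natTrailingDegree_eq {f : MvPolynomial σ R}
    (h : (scaleVariables f).natTrailingDegree = (scaleVariables f).natDegree) :
    f.IsHomogeneous (scaleVariables f).natDegree := by
  have hz : ∀ m, m ≠ (scaleVariables f).natDegree → homogeneousComponent m f = 0 := by
    intro m hm
    rw [← coeff_scaleVariables]
    rcases hm.lt_or_gt with h' | h'
    · exact Polynomial.coeff_eq_zero_of_lt_natTrailingDegree (h ▸ h')
    · exact Polynomial.coeff_eq_zero_of_natDegree_lt h'
  rw [← sum_homogeneousComponent f]
  refine IsHomogeneous.sum _ _ _ fun m _ => ?_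
  rw [sum_homogeneousComponent f]
  by_cases hm : m = (scaleVariables f).natDegree
  · exact hm ▸ homogeneousComponent_isHomogeneous m f
  · exact hz m hm ▸ isHomogeneous_zero _ _ _

/-- Factors of a nonzero homogeneous polynomial over a domain are homogeneous. -/
theorem IsHomogeneous.exists_of_mul [IsDomain R] {p q : MvPolynomial σ R} {n : ℕ}
    (hp : p ≠ 0) (hq : q ≠ 0) (h : (p * q).IsHomogeneous n) :
    ∃ i j, i + j = n ∧ p.IsHomogeneous i ∧ q.IsHomogeneous j := by
  have hp' := scaleVariables_ne_zero hp
  have hq' := scaleVariables_ne_zero hq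
  have hmul := isHomogeneous_iff_scaleVariables.mp h
  rw [map_mul] at hmul
  have hdeg := congrArg Polynomial.natDegree hmul
  have htrail := congrArg Polynomial.natTrailingDegree hmul
  rw [Polynomial.natDegree_mul hp' hq',
    Polynomial.natDegree_monomial_eq _ (mul_ne_zero hp hq)] at hdeg
  rw [Polynomial.natTrailingDegree_mul hp' hq',
    Polynomial.natTrailingDegree_monomial (mul_ne_zero hp hq)] at htrail
  have h₁ := Polynomial.natTrailingDegree_le_natDegree (scaleVariables p)
  have h₂ := Polynomial.natTrailingDegree_le_natDegree (scaleVariables q)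
  exact ⟨_, _, hdeg, isHomogeneous_of_natTrailingDegree_eq (by omega),
    isHomogeneous_of_natTrailingDegree_eq (by omega)⟩

end Homogenization

section Counting

variable (k : Type*) [Field k]

/-- Nonzero homogeneous binary forms of degree `n`. -/
abbrev NonzeroForm (n : ℕ) : Type _ :=
  {p : MvPolynomial (Fin 2) k // p ≠ 0 ∧ p.IsHomogeneous n}

/-- Relatively prime pairs of nonzero binary forms of degrees `t` and `w`. -/
abbrev CoprimeForms (t w : ℕ) : Type _ :=
  {pq : MvPolynomial (Fin 2) k × MvPolynomial (Fin 2) k //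
    pq.1 ≠ 0 ∧ pq.2 ≠ 0 ∧ pq.1.IsHomogeneous t ∧ pq.2.IsHomogeneous w ∧
      ∀ D : MvPolynomial (Fin 2) k, D ∣ pq.1 → D ∣ pq.2 → IsUnit D}

/-- Exponents of binary monomials of degree `n` correspond to the antidiagonal of `n`. -/
noncomputable def degreeEqEquivAntidiagonal (n : ℕ) :
    {d : Fin 2 →₀ ℕ | d.degree = n} ≃ Finset.HasAntidiagonal.antidiagonal n :=
  (finTwoArrowEquiv' ℕ).subtypeEquiv fun d => by
    simp [finTwoArrowEquiv', Finsupp.degree_eq_sum]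

/-- Binary forms of degree `n` correspond to their coefficient vectors. -/
noncomputable def homogeneousSubmoduleEquivFun (n : ℕ) :
    homogeneousSubmodule (Fin 2) k n ≃ (Finset.HasAntidiagonal.antidiagonal n → k) :=
  (Equiv.setCongr (by
      rw [homogeneousSubmodule_eq_finsupp_supported])).trans <|
    (AddMonoidAlgebra.supportedEquivFinsupp
      {d : Fin 2 →₀ ℕ | d.degree = n}).toEquiv.trans <|
    (Finsupp.domCongr (degreeEqEquivAntidiagonal n)).toEquiv.trans Finsupp.equivFunOnFinite

/-- Multiplying a coprime pair by a common factor, and recording the leading coefficient of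
that factor. -/
noncomputable def scaleCoprime (a b m : ℕ)
    (x : Σ ij : Finset.HasAntidiagonal.antidiagonal m,
      NonzeroForm k ij.1.1 × CoprimeForms k (a + ij.1.2) (b + ij.1.2)) :
    (NonzeroForm k (a + m) × NonzeroForm k (b + m)) × kˣ :=
  have hij := Finset.HasAntidiagonal.mem_antidiagonal.mp x.1.2
  ((⟨x.2.1.1 * x.2.2.1.1, mul_ne_zero x.2.1.2.1 x.2.2.2.1, by
      convert x.2.1.2.2.mul x.2.2.2.2.2.1 using 1; omega⟩,
    ⟨x.2.1.1 * x.2.2.1.2, mul_ne_zero x.2.1.2.1 x.2.2.2.2.1, by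
      convert x.2.1.2.2.mul x.2.2.2.2.2.2.1 using 1; omega⟩),
   Units.mk0 (MonomialOrder.lex.leadingCoeff x.2.1.1)
    (MonomialOrder.lex.leadingCoeff_ne_zero_iff.mpr x.2.1.2.1))

theorem scaleCoprime_injective (a b m : ℕ) : Function.Injective (scaleCoprime k a b m) := by
  let _ := UniqueFactorizationMonoid.toGCDMonoid (MvPolynomial (Fin 2) k)
  have key : ∀ D P Q D' P' Q' : MvPolynomial (Fin 2) k, IsRelPrime P' Q' →
      D * P = D' * P' → D * Q = D' * Q' → D ∣ D' := by
    intro D P Q D' P' Q' h hP hQ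
    have h₁ : D ∣ gcd (D' * P') (D' * Q') := dvd_gcd ⟨P, hP.symm⟩ ⟨Q, hQ.symm⟩
    have h₂ := gcd_mul_left' D' P' Q'
    have h₃ : IsUnit (gcd P' Q') := gcd_isUnit_iff_isRelPrime.mpr h
    exact h₃.dvd_mul_right.mp (h₁.trans h₂.dvd)
  rintro ⟨⟨⟨i, j⟩, hij⟩, ⟨D, hD, hDi⟩, ⟨⟨P, Q⟩, hP, hQ, hPt, hQw, hPQ⟩⟩
    ⟨⟨⟨i', j'⟩, hij'⟩, ⟨D', hD', hDi'⟩, ⟨⟨P', Q'⟩, hP', hQ', hPt', hQw', hPQ'⟩⟩ h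
  simp only [scaleCoprime, Prod.mk.injEq, Subtype.mk.injEq, Units.mk0_inj] at h
  obtain ⟨⟨h₁, h₂⟩, h₃⟩ := h
  obtain ⟨u, hu⟩ := associated_of_dvd_dvd
    (key D P Q D' P' Q' (fun d => hPQ' d) h₁ h₂)
    (key D' P' Q' D P Q (fun d => hPQ d) h₁.symm h₂.symm)
  obtain ⟨c, -, hc⟩ := isUnit_iff_eq_C_of_isReduced.mp u.isUnit
  have hDD : D = D' := by
    have hl := congrArg MonomialOrder.lex.leadingCoeff hu
    rw [MonomialOrder.lex.leadingCoeff_mul, hc,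
      MonomialOrder.leadingCoeff_C, ← h₃] at hl
    have hc1 : c = 1 := by
      simpa [hD] using hl
    rw [← hu, hc, hc1, C_1, mul_one]
  subst hDD
  obtain rfl := mul_left_cancel₀ hD h₁
  obtain rfl := mul_left_cancel₀ hD h₂
  obtain rfl := hDi.inj_right hDi' hD
  obtain rfl : j = j' := by
    simp only [Finset.HasAntidiagonal.mem_antidiagonal] at hij hij'
    omega
  rfl

theorem scaleCoprime_surjective {a b : ℕ} (m : ℕ) (hab : a = 0 ∨ b = 0) :
    Function.Surjective (scaleCoprime k a b m) := by
  let _ := UniqueFactorizationMonoid.toGCDMonoid (MvPolynomial (Fin 2) k)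
  rintro ⟨⟨⟨P, hP, hPt⟩, ⟨Q, hQ, hQw⟩⟩, u⟩
  obtain ⟨P', Q', hPe, hQe, hg⟩ := extract_gcd P Q
  generalize gcd P Q = G at hPe hQe
  subst hPe hQe
  have hG := left_ne_zero_of_mul hP
  have hlG : MonomialOrder.lex.leadingCoeff G ≠ 0 :=
    MonomialOrder.lex.leadingCoeff_ne_zero_iff.mpr hG
  set c : k := u * (MonomialOrder.lex.leadingCoeff G)⁻¹ with hc
  have hc0 : c ≠ 0 := mul_ne_zero u.ne_zero (inv_ne_zero hlG)
  have hcc : (C c : MvPolynomial (Fin 2) k) * C c⁻¹ = 1 := by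
    rw [← C_mul, mul_inv_cancel₀ hc0, C_1]
  have hC0 : (C c : MvPolynomial (Fin 2) k) ≠ 0 := left_ne_zero_of_mul_eq_one hcc
  have hCi0 : (C c⁻¹ : MvPolynomial (Fin 2) k) ≠ 0 := right_ne_zero_of_mul_eq_one hcc
  have hCu : IsUnit (C c⁻¹ : MvPolynomial (Fin 2) k) := IsUnit.of_mul_eq_one_right _ hcc
  have hP' := right_ne_zero_of_mul hP
  have hQ' := right_ne_zero_of_mul hQ
  obtain ⟨i, j, hij, hGi, hPj⟩ := hPt.exists_of_mul hG hP'
  obtain ⟨i', l, hil, hGi', hQl⟩ := hQw.exists_of_mul hG hQ'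
  obtain rfl := hGi.inj_right hGi' hG
  obtain ⟨e, rfl⟩ : ∃ e, m = i + e := Nat.exists_eq_add_of_le (by omega)
  obtain rfl : j = a + e := by omega
  obtain rfl : l = b + e := by omega
  refine ⟨⟨⟨(i, e), by simp⟩, ⟨C c * G, mul_ne_zero hC0 hG, hGi.C_mul c⟩,
    ⟨(C c⁻¹ * P', C c⁻¹ * Q'), mul_ne_zero hCi0 hP', mul_ne_zero hCi0 hQ',
      hPj.C_mul _, hQl.C_mul _, fun D h₁ h₂ => ?_⟩⟩, ?_⟩
  · exact gcd_isUnit_iff_isRelPrime.mp hg (hCu.dvd_mul_left.mp h₁) (hCu.dvd_mul_left.mp h₂)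
  · simp only [scaleCoprime, Prod.mk.injEq, Subtype.mk.injEq]
    refine ⟨⟨?_, ?_⟩, Units.ext ?_⟩
    · linear_combination (G * P') * hcc
    · linear_combination (G * Q') * hcc
    · rw [Units.val_mk0, MonomialOrder.lex.leadingCoeff_mul, MonomialOrder.leadingCoeff_C,
        hc, inv_mul_cancel_right₀ hlG]

theorem card_homogeneousSubmodule (n : ℕ) :
    Nat.card (homogeneousSubmodule (Fin 2) k n) = Nat.card k ^ (n + 1) := by
  rw [Nat.card_congr (homogeneousSubmoduleEquivFun k n), Nat.card_fun,
    Nat.card_eq_fintype_card (α := Finset.HasAntidiagonal.antidiagonal n),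
    Fintype.card_coe, Finset.Nat.card_antidiagonal]

variable [Finite k]

instance (n : ℕ) : Finite (homogeneousSubmodule (Fin 2) k n) :=
  Finite.of_equiv _ (homogeneousSubmoduleEquivFun k n).symm

/-- Nonzero forms are the nonzero elements of the homogeneous submodule. -/
def nonzeroFormEquiv (n : ℕ) :
    NonzeroForm k n ≃ {p : homogeneousSubmodule (Fin 2) k n // p ≠ 0} where
  toFun p := ⟨⟨p.1, p.2.2⟩, fun h => p.2.1 (congrArg Subtype.val h)⟩
  invFun p := ⟨p.1.1, fun h => p.2 (Subtype.ext h), p.1.2⟩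

instance (n : ℕ) : Finite (NonzeroForm k n) := Finite.of_equiv _ (nonzeroFormEquiv k n).symm

theorem card_nonzeroForm (n : ℕ) : Nat.card (NonzeroForm k n) = Nat.card k ^ (n + 1) - 1 := by
  classical
  have := Fintype.ofFinite (homogeneousSubmodule (Fin 2) k n)
  rw [Nat.card_congr (nonzeroFormEquiv k n), Nat.card_eq_fintype_card,
    Fintype.card_subtype_compl, Fintype.card_subtype_eq, ← Nat.card_eq_fintype_card,
    card_homogeneousSubmodule]

instance (t w : ℕ) : Finite (CoprimeForms k t w) :=
  Finite.of_injective
    (fun x => ((⟨x.1.1, x.2.1, x.2.2.2.1⟩, ⟨x.1.2, x.2.2.1, x.2.2.2.2.1⟩) :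
      NonzeroForm k t × NonzeroForm k w))
    fun x y h => by
      simp only [Prod.mk.injEq, Subtype.mk.injEq] at h
      exact Subtype.ext (Prod.ext h.1 h.2)

/-- Sorting pairs of nonzero forms by their greatest common divisor. -/
theorem sum_card_coprimeForms {a b : ℕ} (m : ℕ) (hab : a = 0 ∨ b = 0) :
    ∑ ij ∈ Finset.HasAntidiagonal.antidiagonal m, (Nat.card k ^ (ij.1 + 1) - 1) *
        Nat.card (CoprimeForms k (a + ij.2) (b + ij.2)) =
      (Nat.card k ^ (a + m + 1) - 1) * (Nat.card k ^ (b + m + 1) - 1) * (Nat.card k - 1) := by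
  have h := Nat.card_eq_of_bijective _
    ⟨scaleCoprime_injective k a b m, scaleCoprime_surjective k m hab⟩
  rw [Nat.card_sigma, Nat.card_prod, Nat.card_prod, Nat.card_units] at h
  simp only [Nat.card_prod, card_nonzeroForm] at h
  rw [← h]
  exact (Finset.sum_coe_sort (Finset.HasAntidiagonal.antidiagonal m) fun ij =>
    (Nat.card k ^ (ij.1 + 1) - 1) * Nat.card (CoprimeForms k (a + ij.2) (b + ij.2))).symm

end Counting

end MvPolynomial

/-- Solving a convolution recurrence with kernel `q ^ (i + 1) - 1`. -/
theorem sum_range_of_sum_antidiagonal_pow_sub_one {q : ℤ} (hq : q ≠ 1) {a b : ℕ} {A : ℕ → ℤ}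
    (hab : a = 0 ∨ b = 0)
    (h : ∀ m, ∑ ij ∈ Finset.HasAntidiagonal.antidiagonal m, (q ^ (ij.1 + 1) - 1) * A ij.2 =
      (q ^ (a + m + 1) - 1) * (q ^ (b + m + 1) - 1) * (q - 1)) (m : ℕ) :
    ∑ j ∈ Finset.range (m + 1), A j = (q - 1) * (q ^ (a + b + 2 * m + 1) - 1) := by
  have hq' : q - 1 ≠ 0 := sub_ne_zero.mpr hq
  apply mul_left_cancel₀ hq'
  cases m with
  | zero =>
    have h0 := h 0
    simp only [Finset.Nat.antidiagonal_zero, Finset.sum_singleton] at h0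
    rcases hab with rfl | rfl <;> simpa [hq', mul_comm] using h0
  | succ m =>
    have h0 := h m
    have h1 := h (m + 1)
    rw [Finset.Nat.sum_antidiagonal_succ] at h1
    have hs : ∑ ij ∈ Finset.HasAntidiagonal.antidiagonal m, (q ^ (ij.1 + 1 + 1) - 1) * A ij.2 =
        q * ∑ ij ∈ Finset.HasAntidiagonal.antidiagonal m, (q ^ (ij.1 + 1) - 1) * A ij.2 +
          (q - 1) * ∑ ij ∈ Finset.HasAntidiagonal.antidiagonal m, A ij.2 := by
      rw [Finset.mul_sum, Finset.mul_sum, ← Finset.sum_add_distrib]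
      exact Finset.sum_congr rfl fun _ _ => by ring
    have hr : ∑ ij ∈ Finset.HasAntidiagonal.antidiagonal m, A ij.2 = ∑ j ∈ Finset.range (m + 1), A j := by
      rw [← Finset.Nat.sum_antidiagonal_swap]
      exact Finset.Nat.sum_antidiagonal_eq_sum_range_succ_mk (fun ij => A ij.1) m
    rw [hs, hr, h0] at h1
    rw [Finset.sum_range_succ]
    linear_combination h1

/-- Counting coprime pairs of homogeneous polynomials over a finite field `k` with `q`
elements: the number `a_{t,w}` of ordered pairs `(P, Q)` of nonzero homogeneous polynomials
in `k[X,Y]` of degrees `t` and `w` which are relatively prime (every common divisor is a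
unit) equals `(q-1)(q^{t+w+1} - 1)` if `t = 0` or `w = 0`, and
`(q-1)(q²-1)q^{t+w-1}` if `t ≥ 1` and `w ≥ 1`. -/
theorem card_coprime_homogeneous_pairs
    (k : Type) [Field k] [Fintype k] (t w : ℕ) :
    ((t = 0 ∨ w = 0) →
      Nat.card {pq : MvPolynomial (Fin 2) k × MvPolynomial (Fin 2) k //
          pq.1 ≠ 0 ∧ pq.2 ≠ 0 ∧ pq.1.IsHomogeneous t ∧ pq.2.IsHomogeneous w ∧
            ∀ D : MvPolynomial (Fin 2) k, D ∣ pq.1 → D ∣ pq.2 → IsUnit D}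
        = (Fintype.card k - 1) * (Fintype.card k ^ (t + w + 1) - 1)) ∧
    (1 ≤ t → 1 ≤ w →
      Nat.card {pq : MvPolynomial (Fin 2) k × MvPolynomial (Fin 2) k //
          pq.1 ≠ 0 ∧ pq.2 ≠ 0 ∧ pq.1.IsHomogeneous t ∧ pq.2.IsHomogeneous w ∧
            ∀ D : MvPolynomial (Fin 2) k, D ∣ pq.1 → D ∣ pq.2 → IsUnit D}
        = (Fintype.card k - 1) * (Fintype.card k ^ 2 - 1)
            * Fintype.card k ^ (t + w - 1)) := by
  obtain ⟨a, b, m, hab, rfl, rfl⟩ :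
      ∃ a b m, (a = 0 ∨ b = 0) ∧ t = a + m ∧ w = b + m :=
    ⟨t - min t w, w - min t w, min t w, by omega, by omega, by omega⟩
  have hq := Fintype.one_lt_card (α := k)
  have hsum : ∀ m, ∑ j ∈ Finset.range (m + 1),
      (Nat.card (MvPolynomial.CoprimeForms k (a + j) (b + j)) : ℤ) =
        ((Fintype.card k : ℤ) - 1) * ((Fintype.card k : ℤ) ^ (a + b + 2 * m + 1) - 1) := by
    refine sum_range_of_sum_antidiagonal_pow_sub_one (by exact_mod_cast hq.ne') hab fun m => ?_
    have h := congrArg (Nat.cast : ℕ → ℤ) (MvPolynomial.sum_card_coprimeForms k m hab)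
    have hpow : ∀ n, ((Fintype.card k ^ n - 1 : ℕ) : ℤ) = (Fintype.card k : ℤ) ^ n - 1 :=
      fun n => by rw [Nat.cast_sub (Nat.one_le_pow _ _ (by omega))]; simp
    rw [Nat.card_eq_fintype_card] at h
    simp only [Nat.cast_sum, Nat.cast_mul, hpow, Nat.cast_sub hq.le, Nat.cast_one] at h
    exact h
  zify [hq.le, Nat.one_le_pow _ _ (zero_lt_one.trans hq)]
  refine ⟨fun h => ?_, fun ht hw => ?_⟩
  · obtain rfl : m = 0 := by omega
    simpa using hsum 0
  · obtain ⟨n, rfl⟩ : ∃ n, m = n + 1 := ⟨m - 1, by omega⟩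
    have h := hsum (n + 1)
    rw [Finset.sum_range_succ, hsum n] at h
    rw [show a + (n + 1) + (b + (n + 1)) - 1 = a + b + 2 * n + 1 by omega]
    linear_combination h
end
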